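/- arXiv:0901.0253 — 2 statements merged into one kernel-verified Lean document; each statement's English description precedes it below -/
import Mathlib

section
/- Let G be a simple graph with Orlik–Terao ideal I_G ⊆ R = K[y_e : e ∈ E(G)], and let κ_i denote the number of induced complete subgraphs of G isomorphic to K_{i+1}. Then the linear strand of the resolution of R/I_G is: dim_K Tor_1^R(R/I_G, K)_2 = κ_2, dim_K Tor_2^R(R/I_G, K)_3 = 2κ_3, and dim_K Tor_i^R(R/I_G, K)_{i+1} = 0 for all i ≥ 3. -/
open MvPolynomial

/-- An essential central arrangement of hyperplanes in `K^n`, with hyperplanes indexed by `ι`: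
the hyperplane `H i` is the kernel of the nonzero linear form with coefficient vector `form i`,
the forms are pairwise non-proportional (the hyperplanes are distinct), and they span the dual
space (the arrangement is essential, i.e. has rank `n`). -/
structure CentralArrangement (K : Type*) [Field K] (ι : Type*) [Fintype ι] (n : ℕ) where
  form : ι → (Fin n → K)
  nonzero : ∀ i, form i ≠ 0
  nonProportional : ∀ i j, i ≠ j → ∀ t : K, form i ≠ t • form j
  essential : Submodule.span K (Set.range form) = ⊤

namespace CentralArrangement

variable {K : Type*} [Field K] {ι : Type*} [Fintype ι] {n : ℕ}

/-- The evaluation map `K^ι → K[x_1,…,x_n]_1 ≅ K^n`, sending `e i` to the form `α i`. -/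
noncomputable def evalMap (A : CentralArrangement K ι n) : (ι → K) →ₗ[K] (Fin n → K) where
  toFun c := ∑ i, c i • A.form i
  map_add' x y := by
    simp [add_smul, Finset.sum_add_distrib]
  map_smul' t x := by
    simp [smul_smul, Finset.smul_sum]

/-- The relation space `F(A)`: the kernel of the evaluation map. -/
noncomputable def relSpace (A : CentralArrangement K ι n) : Submodule K (ι → K) :=
  LinearMap.ker A.evalMap

end CentralArrangement

open Classical in
/-- The support of a vector `c : ι → K`, as a finset. -/
noncomputable def vsupp {K ι : Type*} [Field K] [Fintype ι] (c : ι → K) : Finset ι :=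
  Finset.univ.filter fun j => c j ≠ 0

/-- The Orlik-Terao boundary `∂(c) = Σ_{j ∈ Λ} c_j · Π_{l ∈ Λ, l ≠ j} y_l`, where
`Λ` is the support of the dependency `c`. -/
noncomputable def otgen {K ι : Type*} [Field K] [Fintype ι] [DecidableEq ι] (c : ι → K) :
    MvPolynomial ι K :=
  ∑ j ∈ vsupp c, MvPolynomial.C (c j) * ∏ l ∈ (vsupp c).erase j, MvPolynomial.X l

namespace CentralArrangement

variable {K : Type*} [Field K] {ι : Type*} [Fintype ι] [DecidableEq ι] {n : ℕ}

/-- The Orlik-Terao ideal `I`, generated by `∂(c)` for all relations `c ∈ F(A)`. -/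
noncomputable def otIdeal (A : CentralArrangement K ι n) : Ideal (MvPolynomial ι K) :=
  Ideal.span (otgen '' (A.relSpace : Set (ι → K)))

/-- The quadratic component `I₂` of the Orlik-Terao ideal: the ideal generated by the
degree-2 (homogeneous) elements of `I`. -/
noncomputable def otQuadratic (A : CentralArrangement K ι n) : Ideal (MvPolynomial ι K) :=
  Ideal.span {f | f ∈ A.otIdeal ∧ f.IsHomogeneous 2}

/-- A 3-relation is an element of `F(A)` with support of size 3; the arrangement is
2-formal if the 3-relations span the relation space. -/
def IsTwoFormal (A : CentralArrangement K ι n) : Prop :=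
  Submodule.span K {c : ι → K | c ∈ A.relSpace ∧ (vsupp c).card = 3} = A.relSpace

end CentralArrangement
section GraphicArrangement

variable (K : Type*) [Field K] {V : Type*} [Fintype V] [DecidableEq V]
variable (G : SimpleGraph V) [DecidableRel G.Adj]

/-- The defining linear form `z_i − z_j` of the hyperplane of the graphic arrangement `A_G`
corresponding to the edge `e = {i, j}` (for a fixed choice of orientation of `e`). -/
noncomputable def graphForm (e : G.edgeSet) : V → K :=
  Pi.single (Quot.out (e : Sym2 V)).1 (1 : K) -
    Pi.single (Quot.out (e : Sym2 V)).2 (1 : K)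

/-- The evaluation map `K^{E(G)} → K^V` of the graphic arrangement, `e ↦ z_i − z_j`. -/
noncomputable def graphEvalMap : (G.edgeSet → K) →ₗ[K] (V → K) where
  toFun c := ∑ e, c e • graphForm K G e
  map_add' x y := by
    simp [add_smul, Finset.sum_add_distrib]
  map_smul' t x := by
    simp [smul_smul, Finset.smul_sum]

/-- The relation space of the graphic arrangement `A_G`. -/
noncomputable def graphRelSpace : Submodule K (G.edgeSet → K) :=
  LinearMap.ker (graphEvalMap K G)

/-- The Orlik-Terao ideal `I_G` of the graphic arrangement `A_G`, in the polynomial ring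
`K[y_e : e ∈ E(G)]`. -/
noncomputable def graphOTIdeal : Ideal (MvPolynomial G.edgeSet K) :=
  Ideal.span (otgen '' (graphRelSpace K G : Set (G.edgeSet → K)))

end GraphicArrangement

/-- A minimal graded free resolution of `R/I` over the polynomial ring
`R = K[y_i : i ∈ ι]`:  free graded modules `F_i = ⊕_{r} R(−deg i r)` of rank `rk i`
(with `F_0 = R`), differentials given by matrices of homogeneous polynomials with entries in
the irrelevant maximal ideal (minimality), exact as an augmented complex with
`im(F_1 → F_0) = I` and `rk i = 0` for `i > len`.  The graded Betti number
`b_{i,j} = dim_K Tor_i^R(R/I, K)_j` is then the number of indices `r` with `deg i r = j`. -/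
structure MinGradedFreeRes (K : Type*) [Field K] (ι : Type*) [Fintype ι]
    (I : Ideal (MvPolynomial ι K)) where
  /-- the length of the resolution -/
  len : ℕ
  /-- the rank of the free module `F_i` -/
  rk : ℕ → ℕ
  rk_zero : rk 0 = 1
  rk_eventually_zero : ∀ i, len < i → rk i = 0
  /-- the internal degrees of the free generators of `F_i` -/
  deg : (i : ℕ) → Fin (rk i) → ℕ
  deg_zero : ∀ r, deg 0 r = 0
  /-- the matrix of the differential `F_{i+1} → F_i` -/
  mat : (i : ℕ) → Matrix (Fin (rk (i + 1))) (Fin (rk i)) (MvPolynomial ι K)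
  /-- the differentials are graded of degree 0 -/
  homog : ∀ i r c, (mat i r c).IsHomogeneous (deg (i + 1) r - deg i c)
  /-- minimality: all entries lie in the irrelevant maximal ideal -/
  minimal : ∀ i r c, MvPolynomial.coeff 0 (mat i r c) = 0
  /-- exactness of the complex -/
  exact : ∀ i,
    LinearMap.range (mat (i + 1)).vecMulLinear = LinearMap.ker (mat i).vecMulLinear
  /-- the image of `F_1 → F_0 = R` is exactly `I` -/
  aug : LinearMap.range (mat 0).vecMulLinear =
    Submodule.pi Set.univ
      fun _ : Fin (rk 0) => (I : Submodule (MvPolynomial ι K) (MvPolynomial ι K))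

/-- Every complex of finite free modules over `R`, exact in positive degrees, whose matrices have
entries in the kernel of the augmentation `ε`, vanishes beyond position `n`. -/
def HasSyzygyBound {R K : Type*} [CommRing R] [Field K] (n : ℕ) (ε : R →+* K) : Prop :=
  ∀ (rk : ℕ → ℕ) (mat : ∀ i, Matrix (Fin (rk (i + 1))) (Fin (rk i)) R),
    (∀ i r c, ε (mat i r c) = 0) →
    (∀ i, LinearMap.range (mat (i + 1)).vecMulLinear = LinearMap.ker (mat i).vecMulLinear) →
    ∀ i, n < i → rk i = 0

namespace HasSyzygyBound

variable {R S K : Type*} [CommRing R] [CommRing S] [Field K]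

theorem of_injective (ε : R →+* K) (hε : Function.Injective ε) : HasSyzygyBound 0 ε := by
  intro rk mat hm hex i hi
  obtain ⟨k, rfl⟩ : ∃ k, i = k + 1 := ⟨i - 1, by omega⟩
  have hz : ∀ i, mat i = 0 := fun i => by
    ext r c
    exact hε (by simp [hm])
  by_contra hne
  have h0 : (fun _ => 1 : Fin (rk (k + 1)) → R) ∈ LinearMap.ker (mat k).vecMulLinear := by
    simp [hz]
  rw [← hex k] at h0
  obtain ⟨v, hv⟩ := h0
  have h1 := congrFun hv ⟨0, Nat.pos_of_ne_zero hne⟩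
  simp only [hz, Matrix.vecMulLinear_apply, Matrix.vecMul_zero, Pi.zero_apply] at h1
  have h2 := congrArg ε h1
  simp at h2

theorem succ {n : ℕ} {ε : S →+* K} (h : HasSyzygyBound n ε) (φ : R →+* S)
    (hφ : Function.Surjective φ) (x : R) (hx : φ x = 0) (hker : ∀ r, φ r = 0 → ∃ s, r = x * s)
    (hreg : ∀ r, x * r = 0 → r = 0) : HasSyzygyBound (n + 1) (ε.comp φ) := by
  intro rk mat hm hex i hi
  obtain ⟨k, rfl⟩ : ∃ k, i = k + 1 := ⟨i - 1, by omega⟩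
  refine h (fun i => rk (i + 1)) (fun i => (mat (i + 1)).map φ) (fun i r c => hm (i + 1) r c)
    (fun i => ?_) k (by omega)
  have hmap : ∀ (j : ℕ) (v : Fin (rk (j + 1)) → R),
      Matrix.vecMul (φ ∘ v) ((mat j).map φ) = φ ∘ Matrix.vecMul v (mat j) := fun j v => by
    ext c; simp [RingHom.map_vecMul]
  have hcomp : ∀ (j : ℕ) (v : Fin (rk (j + 2)) → R),
      Matrix.vecMul (Matrix.vecMul v (mat (j + 1))) (mat j) = 0 := fun j v => by
    have : Matrix.vecMul v (mat (j + 1)) ∈ LinearMap.ker (mat j).vecMulLinear := by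
      rw [← hex j]; exact ⟨v, rfl⟩
    simpa using this
  have hlift : ∀ (j : ℕ) (v : Fin j → S), ∃ w : Fin j → R, φ ∘ w = v := fun j v =>
    ⟨fun c => (hφ (v c)).choose, funext fun c => (hφ (v c)).choose_spec⟩
  have hexact : ∀ (j : ℕ) (v : Fin (rk (j + 1)) → R), Matrix.vecMul v (mat j) = 0 →
      ∃ w, v = Matrix.vecMul w (mat (j + 1)) := fun j v hv => by
    have : v ∈ LinearMap.ker (mat j).vecMulLinear := by simpa using hv
    rw [← hex j] at this
    obtain ⟨w, hw⟩ := this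
    exact ⟨w, hw.symm⟩
  ext v'
  constructor
  · rintro ⟨w', rfl⟩
    obtain ⟨w, rfl⟩ := hlift _ w'
    simp only [LinearMap.mem_ker, Matrix.vecMulLinear_apply]
    rw [hmap, hmap, hcomp]
    ext; simp
  · intro hv'
    obtain ⟨v, rfl⟩ := hlift _ v'
    simp only [LinearMap.mem_ker, Matrix.vecMulLinear_apply] at hv'
    rw [hmap] at hv'
    have h1 : ∀ c, ∃ s, Matrix.vecMul v (mat (i + 1)) c = x * s := fun c =>
      hker _ (congrFun hv' c)
    choose w hw using h1
    have hw' : Matrix.vecMul v (mat (i + 1)) = x • w := funext hw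
    have h2 : Matrix.vecMul w (mat i) = 0 := by
      have h3 := hcomp i v
      rw [hw', Matrix.smul_vecMul] at h3
      ext c
      exact hreg _ (congrFun h3 c)
    obtain ⟨u, rfl⟩ := hexact _ _ h2
    obtain ⟨t, ht⟩ := hexact (i + 1) (v - x • u) (by
      rw [Matrix.sub_vecMul, hw', Matrix.smul_vecMul, sub_self])
    refine ⟨φ ∘ t, ?_⟩
    rw [Matrix.vecMulLinear_apply, hmap, ← ht]
    ext c
    simp [hx]

theorem of_equiv {n : ℕ} {ε : S →+* K} (h : HasSyzygyBound n ε) (e : R ≃+* S) :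
    HasSyzygyBound n (ε.comp (e : R →+* S)) := by
  intro rk mat hm hex
  refine h rk (fun i => (mat i).map e) (fun i r c => hm i r c) fun i => ?_
  have hmap : ∀ (j : ℕ) (v : Fin (rk (j + 1)) → R),
      Matrix.vecMul (e ∘ v) ((mat j).map e) = e ∘ Matrix.vecMul v (mat j) := fun j v => by
    ext c
    simpa using (RingHom.map_vecMul (e : R →+* S) (mat j) v c).symm
  have hlift : ∀ (j : ℕ) (v : Fin j → S), ∃ w : Fin j → R, e ∘ w = v := fun j v =>
    ⟨e.symm ∘ v, funext fun c => by simp⟩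
  have hexact : ∀ v, v ∈ LinearMap.range (mat (i + 1)).vecMulLinear ↔
      v ∈ LinearMap.ker (mat i).vecMulLinear := fun v => by rw [hex]
  ext v'
  obtain ⟨v, rfl⟩ := hlift _ v'
  have h1 : e ∘ v ∈ LinearMap.ker ((mat i).map e).vecMulLinear ↔
      v ∈ LinearMap.ker (mat i).vecMulLinear := by
    simp only [LinearMap.mem_ker, Matrix.vecMulLinear_apply]
    rw [hmap]
    simp [funext_iff]
  rw [h1, ← hexact]
  constructor
  · rintro ⟨w', hw⟩
    obtain ⟨w, rfl⟩ := hlift _ w'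
    rw [Matrix.vecMulLinear_apply, hmap] at hw
    exact ⟨w, funext fun c => e.injective (congrFun hw c)⟩
  · rintro ⟨w, rfl⟩
    exact ⟨e ∘ w, by rw [Matrix.vecMulLinear_apply, hmap]; rfl⟩

end HasSyzygyBound

theorem MvPolynomial.hasSyzygyBound_fin (K : Type*) [Field K] (n : ℕ) :
    HasSyzygyBound n (constantCoeff : MvPolynomial (Fin n) K →+* K) := by
  induction n with
  | zero =>
    refine HasSyzygyBound.of_injective _ fun p q h => ?_
    obtain ⟨a, rfl⟩ := C_surjective (Fin 0) p
    obtain ⟨b, rfl⟩ := C_surjective (Fin 0) q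
    simpa using h
  | succ n ih =>
    have h1 := (ih.succ (Polynomial.constantCoeff : Polynomial (MvPolynomial (Fin n) K) →+* _)
      (fun p => ⟨Polynomial.C p, by simp⟩) Polynomial.X (by simp)
      (fun r hr => Polynomial.X_dvd_iff.2 hr)
      (fun r hr => by simpa using hr)).of_equiv (finSuccEquiv K n).toRingEquiv
    convert h1 using 1
    ext i
    · simp [finSuccEquiv_apply]
    · refine Fin.cases ?_ (fun i => ?_) i <;> simp [finSuccEquiv_X_zero, finSuccEquiv_X_succ]

theorem MvPolynomial.hasSyzygyBound (K : Type*) [Field K] (σ : Type*) [Fintype σ] :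
    HasSyzygyBound (Fintype.card σ) (constantCoeff : MvPolynomial σ K →+* K) := by
  have h := (hasSyzygyBound_fin K (Fintype.card σ)).of_equiv
    (renameEquiv K (Fintype.equivFin σ)).toRingEquiv
  convert h using 1
  ext i <;> simp

section GradedFree

variable {σ K : Type*} [Field K] {κ κ' : Type*}

theorem MvPolynomial.homogeneousComponent_mul_of_isHomogeneous {q : MvPolynomial σ K} {t : ℕ}
    (hq : q.IsHomogeneous t) (n : ℕ) (p : MvPolynomial σ K) :
    homogeneousComponent n (p * q) =
      if t ≤ n then homogeneousComponent (n - t) p * q else 0 := by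
  have h1 : ∀ i, homogeneousComponent n (homogeneousComponent i p * q) =
      if i + t = n then homogeneousComponent i p * q else 0 := fun i => by
    have h := (homogeneousComponent_isHomogeneous i p).mul hq
    rw [homogeneousComponent_of_mem h]
    simp [eq_comm]
  conv_lhs => rw [← sum_homogeneousComponent p, Finset.sum_mul, map_sum]
  simp_rw [h1]
  split_ifs with h
  · rw [Finset.sum_eq_single (n - t)]
    · simp [h]
    · intro b _ hb
      rw [if_neg (by omega)]
    · intro hb
      rw [homogeneousComponent_eq_zero _ _ (by simp at hb; omega)]
      simp
  · exact Finset.sum_eq_zero fun i _ => if_neg (by omega)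

/-- The degree `j` part of the graded free module `⊕ R(-d c)`. -/
def gradedPart (d : κ → ℕ) (j : ℕ) : Submodule K (κ → MvPolynomial σ K) where
  carrier := {v | ∀ c, (d c ≤ j → (v c).IsHomogeneous (j - d c)) ∧ (j < d c → v c = 0)}
  add_mem' hv hw c := ⟨fun h => ((hv c).1 h).add ((hw c).1 h),
    fun h => by simp [(hv c).2 h, (hw c).2 h]⟩
  zero_mem' c := ⟨fun _ => isHomogeneous_zero _ _ _, fun _ => rfl⟩
  smul_mem' a v hv c := ⟨fun h => by
    rw [Pi.smul_apply, smul_eq_C_mul]; exact ((hv c).1 h).C_mul a, fun h => by simp [(hv c).2 h]⟩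

/-- The projection of `⊕ R(-d c)` to its degree `j` part. -/
noncomputable def gradedComp (d : κ → ℕ) (j : ℕ) :
    (κ → MvPolynomial σ K) →ₗ[K] (κ → MvPolynomial σ K) :=
  LinearMap.pi fun c =>
    if d c ≤ j then (homogeneousComponent (j - d c)).comp (LinearMap.proj c) else 0

theorem gradedComp_apply (d : κ → ℕ) (j : ℕ) (v : κ → MvPolynomial σ K) (c : κ) :
    gradedComp d j v c = if d c ≤ j then homogeneousComponent (j - d c) (v c) else 0 := by
  unfold gradedComp
  rw [LinearMap.pi_apply]
  split_ifs <;> simp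

theorem gradedComp_mem (d : κ → ℕ) (j : ℕ) (v : κ → MvPolynomial σ K) :
    gradedComp d j v ∈ gradedPart d j := fun c => by
  rw [gradedComp_apply]
  exact ⟨fun h => by rw [if_pos h]; exact homogeneousComponent_isHomogeneous _ _,
    fun h => if_neg (by omega)⟩

theorem gradedComp_of_mem {d : κ → ℕ} {j : ℕ} {v : κ → MvPolynomial σ K}
    (hv : v ∈ gradedPart d j) : gradedComp d j v = v := by
  ext1 c
  rw [gradedComp_apply]
  split_ifs with h
  · exact homogeneousComponent_eq_self ((hv c).1 h)
  · exact ((hv c).2 (by omega)).symm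

theorem exists_sum_gradedComp [Fintype κ] (d : κ → ℕ) (v : κ → MvPolynomial σ K) :
    ∃ n, ∑ j ∈ Finset.range n, gradedComp d j v = v := by
  refine ⟨∑ c, (d c + (v c).totalDegree + 1), funext fun c => ?_⟩
  set n := ∑ c, (d c + (v c).totalDegree + 1)
  have hn : d c + (v c).totalDegree + 1 ≤ n :=
    Finset.single_le_sum (f := fun c => d c + (v c).totalDegree + 1)
      (fun _ _ => Nat.zero_le _) (Finset.mem_univ c)
  rw [Finset.sum_apply]
  simp_rw [gradedComp_apply]
  obtain ⟨k, hk⟩ : ∃ k, n = d c + ((v c).totalDegree + 1 + k) :=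
    ⟨n - (d c + (v c).totalDegree + 1), by omega⟩
  rw [hk, Finset.sum_range_add, Finset.sum_eq_zero, zero_add, Finset.sum_range_add]
  · conv_rhs => rw [← sum_homogeneousComponent (v c)]
    rw [Finset.sum_congr rfl (g := fun i => homogeneousComponent i (v c)) (fun i _ => by simp),
      add_eq_left]
    exact Finset.sum_eq_zero fun i _ => by
      rw [if_pos (by omega), homogeneousComponent_eq_zero _ _ (by omega)]
  · intro i hi
    rw [if_neg (by simpa using hi)]

theorem gradedComp_vecMul [Fintype κ'] {d : κ → ℕ} {e : κ' → ℕ}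
    {m : Matrix κ' κ (MvPolynomial σ K)} (hm : ∀ k, m k ∈ gradedPart d (e k)) (j : ℕ)
    (v : κ' → MvPolynomial σ K) :
    gradedComp d j (Matrix.vecMul v m) = Matrix.vecMul (gradedComp e j v) m := by
  ext1 c
  rw [gradedComp_apply]
  simp only [Matrix.vecMul, dotProduct, gradedComp_apply]
  rw [map_sum, show ∀ x : MvPolynomial σ K, (if d c ≤ j then x else 0) =
    (if d c ≤ j then (1 : K) else 0) • x from fun x => by split_ifs <;> simp, Finset.smul_sum]
  refine Finset.sum_congr rfl fun k _ => ?_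
  rcases lt_or_ge (e k) (d c) with h | h
  · simp [(hm k c).2 h]
  · rw [homogeneousComponent_mul_of_isHomogeneous ((hm k c).1 h)]
    rcases le_or_gt (d c) j with h1 | h1
    · rcases le_or_gt (e k) j with h2 | h2
      · rw [if_pos h1, if_pos h2, if_pos (by omega), one_smul]
        congr 3
        omega
      · rw [if_neg (by omega : ¬ e k ≤ j),
          if_neg (by omega : ¬ e k - d c ≤ j - d c), smul_zero, zero_mul]
    · rw [if_neg (by omega : ¬ d c ≤ j), if_neg (by omega : ¬ e k ≤ j), zero_smul, zero_mul]

/-- A submodule of `⊕ R(-d c)` is graded if it contains the homogeneous components of its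
elements. -/
def IsGradedSubmodule (d : κ → ℕ)
    (N : Submodule (MvPolynomial σ K) (κ → MvPolynomial σ K)) : Prop :=
  ∀ v ∈ N, ∀ j, gradedComp d j v ∈ N

theorem isGradedSubmodule_ker_vecMulLinear [Fintype κ'] {d : κ → ℕ} {e : κ' → ℕ}
    {m : Matrix κ' κ (MvPolynomial σ K)} (hm : ∀ k, m k ∈ gradedPart d (e k)) :
    IsGradedSubmodule e (LinearMap.ker m.vecMulLinear) := by
  intro v hv j
  rw [LinearMap.mem_ker, Matrix.vecMulLinear_apply] at hv ⊢
  rw [← gradedComp_vecMul hm, hv, map_zero]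

theorem IsGradedSubmodule.exists_finset_generators [Finite σ] [Fintype κ] {d : κ → ℕ}
    {N : Submodule (MvPolynomial σ K) (κ → MvPolynomial σ K)} (hN : IsGradedSubmodule d N) :
    ∃ S : Finset (κ → MvPolynomial σ K),
      (∀ v ∈ S, ∃ j, v ∈ gradedPart d j) ∧ Submodule.span (MvPolynomial σ K) (S : Set _) = N := by
  classical
  obtain ⟨T, hT⟩ := (isNoetherian_def.1 inferInstance N : N.FG)
  choose n hn using exists_sum_gradedComp (σ := σ) (K := K) d
  refine ⟨T.biUnion fun v => (Finset.range (n v)).image fun j => gradedComp d j v, ?_, ?_⟩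
  · intro v hv
    simp only [Finset.mem_biUnion, Finset.mem_image] at hv
    obtain ⟨w, -, j, -, rfl⟩ := hv
    exact ⟨j, gradedComp_mem _ _ _⟩
  · apply le_antisymm
    · rw [Submodule.span_le]
      intro v hv
      simp only [Finset.coe_biUnion, Set.mem_iUnion, Finset.coe_image, Set.mem_image] at hv
      obtain ⟨w, hw, j, -, rfl⟩ := hv
      exact hN _ (hT ▸ Submodule.subset_span hw) j
    · rw [← hT, Submodule.span_le]
      intro v hv
      rw [← hn v]
      refine Submodule.sum_mem _ fun j hj => Submodule.subset_span ?_
      simp only [Finset.coe_biUnion, Set.mem_iUnion, Finset.coe_image, Set.mem_image]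
      exact ⟨v, hv, j, by simpa using hj, rfl⟩

/-- A graded submodule has a homogeneous generating matrix all of whose syzygies have entries in
the irrelevant ideal. -/
theorem IsGradedSubmodule.exists_minimal_generators [Finite σ] [Fintype κ] {d : κ → ℕ}
    {N : Submodule (MvPolynomial σ K) (κ → MvPolynomial σ K)} (hN : IsGradedSubmodule d N) :
    ∃ (s : ℕ) (e : Fin s → ℕ) (m : Matrix (Fin s) κ (MvPolynomial σ K)),
      (∀ k, m k ∈ gradedPart d (e k)) ∧ LinearMap.range m.vecMulLinear = N ∧
      ∀ v, Matrix.vecMul v m = 0 → ∀ k, coeff 0 (v k) = 0 := by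
  classical
  have hex : ∃ n, ∃ S : Finset (κ → MvPolynomial σ K), S.card = n ∧
      (∀ v ∈ S, ∃ j, v ∈ gradedPart d j) ∧
      Submodule.span (MvPolynomial σ K) (S : Set _) = N := by
    obtain ⟨S, h1, h2⟩ := hN.exists_finset_generators
    exact ⟨_, S, rfl, h1, h2⟩
  obtain ⟨S, hS, hhom, hspan⟩ := Nat.find_spec hex
  choose! deg hdeg using hhom
  let ψ := S.equivFin.symm
  let m : Matrix (Fin S.card) κ (MvPolynomial σ K) := fun k => ψ k
  have hm : ∀ k, m k ∈ gradedPart d (deg (ψ k)) := fun k => hdeg _ (ψ k).2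
  refine ⟨S.card, fun k => deg (ψ k), m, hm, ?_, ?_⟩
  · rw [range_vecMulLinear, ← hspan]
    congr 1
    ext v
    constructor
    · rintro ⟨k, rfl⟩
      exact (ψ k).2
    · intro hv
      exact ⟨ψ.symm ⟨v, hv⟩, by simp [m, Matrix.row]⟩
  · intro v hv k
    by_contra hne
    have h1 := gradedComp_vecMul hm (deg (ψ k)) v
    rw [hv, map_zero] at h1
    set w := gradedComp (fun k => deg (ψ k)) (deg (ψ k)) v
    have hw : w k = C (coeff 0 (v k)) := by
      simp [w, gradedComp_apply, homogeneousComponent_zero]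
    have hmem : m k ∈ Submodule.span (MvPolynomial σ K) ((S.erase (m k) : Finset _) : Set _) := by
      have h2 : w k • m k = - ∑ l ∈ Finset.univ.erase k, w l • m l := by
        rw [eq_neg_iff_add_eq_zero]
        rw [Matrix.vecMul_eq_sum] at h1
        rw [h1]
        exact Finset.add_sum_erase Finset.univ _ (Finset.mem_univ k)
      have h3 : m k = (C (coeff 0 (v k))⁻¹ : MvPolynomial σ K) • (w k • m k) := by
        rw [hw, smul_smul, ← C_mul, inv_mul_cancel₀ hne, C_1, one_smul]
      suffices h4 : (C (coeff 0 (v k))⁻¹ : MvPolynomial σ K) • (w k • m k) ∈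
          Submodule.span (MvPolynomial σ K) ((S.erase (m k) : Finset _) : Set _) by
        rwa [← h3] at h4
      rw [h2]
      refine Submodule.smul_mem _ _ (Submodule.neg_mem _ (Submodule.sum_mem _ fun l hl =>
        Submodule.smul_mem _ _ (Submodule.subset_span ?_)))
      simp only [Finset.coe_erase, Set.mem_sdiff, Finset.mem_coe, Set.mem_singleton_iff]
      refine ⟨(ψ l).2, fun h => (Finset.mem_erase.1 hl).1 (ψ.injective (Subtype.ext h))⟩
    have hkS : m k ∈ S := (ψ k).2
    refine Nat.find_min hex (m := (S.erase (m k)).card) ?_ ⟨_, rfl, ?_, ?_⟩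
    · rw [← hS]
      exact Finset.card_erase_lt_of_mem hkS
    · exact fun v hv => ⟨_, hdeg v (Finset.mem_of_mem_erase hv)⟩
    · rw [← hspan]
      refine le_antisymm (Submodule.span_mono (by simp)) ?_
      rw [Submodule.span_le]
      intro x hx
      by_cases hxk : x = m k
      · rw [hxk]; exact hmem
      · exact Submodule.subset_span (by simpa using ⟨hx, hxk⟩)

end GradedFree

section LinearSyzygies

variable {σ K : Type*} [Field K]

theorem MvPolynomial.IsHomogeneous.eq_C_coeff_zero {p : MvPolynomial σ K}
    (hp : p.IsHomogeneous 0) : p = C (coeff 0 p) := by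
  rw [← homogeneousComponent_zero, homogeneousComponent_eq_self hp]

theorem MvPolynomial.IsHomogeneous.eq_sum_coeff_single [Fintype σ] {p : MvPolynomial σ K}
    (hp : p.IsHomogeneous 1) : p = ∑ e, C (coeff (Finsupp.single e 1) p) * X e := by
  classical
  have h : p ∈ homogeneousSubmodule σ K 1 := hp
  rw [homogeneousSubmodule_one_eq_span_X] at h
  induction h using Submodule.span_induction with
  | mem x hx =>
    obtain ⟨i, rfl⟩ := hx
    rw [Finset.sum_eq_single i]
    · simp
    · intro j _ hj
      rw [coeff_X, if_neg fun h => hj (Finsupp.single_left_injective one_ne_zero h).symm]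
      simp
    · simp
  | zero => simp
  | add x y hx hy ihx ihy =>
    rw [← homogeneousSubmodule_one_eq_span_X] at hx hy
    simp only [coeff_add, C_add, add_mul, Finset.sum_add_distrib]
    rw [← ihx hx, ← ihy hy]
  | smul a x hx ih =>
    rw [← homogeneousSubmodule_one_eq_span_X] at hx
    have h1 : ∀ e, C (coeff (Finsupp.single e 1) (a • x)) * X e =
        C a * (C (coeff (Finsupp.single e 1) x) * X e : MvPolynomial σ K) := fun e => by
      rw [coeff_smul, smul_eq_mul, _root_.MvPolynomial.C_mul, mul_assoc]
    rw [Finset.sum_congr rfl fun e _ => h1 e, ← Finset.mul_sum, ← ih hx, smul_eq_C_mul]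

theorem MvPolynomial.coeff_sum_X_mul [Fintype σ] [DecidableEq σ] (p : σ → MvPolynomial σ K)
    (m : σ →₀ ℕ) :
    coeff m (∑ g, X g * p g) = ∑ g ∈ m.support, coeff (m - Finsupp.single g 1) (p g) := by
  rw [coeff_sum]
  simp_rw [coeff_X_mul']
  rw [Finset.sum_ite_mem, Finset.univ_inter]

theorem MvPolynomial.coeff_self_of_sum_X_mul_eq_zero [Fintype σ] (p : σ → MvPolynomial σ K)
    (h : ∑ f, X f * p f = 0) (e : σ) : coeff (Finsupp.single e 1) (p e) = 0 := by
  classical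
  have h1 := coeff_sum_X_mul p (Finsupp.single e 1 + Finsupp.single e 1)
  rw [h, coeff_zero, ← Finsupp.single_add, Finsupp.support_single _ (by norm_num),
    Finset.sum_singleton, ← Finsupp.single_tsub] at h1
  exact h1.symm

theorem MvPolynomial.coeff_add_coeff_of_sum_X_mul_eq_zero [Fintype σ] (p : σ → MvPolynomial σ K)
    (h : ∑ f, X f * p f = 0) (e f : σ) :
    coeff (Finsupp.single f 1) (p e) + coeff (Finsupp.single e 1) (p f) = 0 := by
  classical
  by_cases hef : e = f
  · rw [hef, coeff_self_of_sum_X_mul_eq_zero p h, add_zero]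
  · have h1 := coeff_sum_X_mul p (Finsupp.single e 1 + Finsupp.single f 1)
    have h2 : Disjoint (Finsupp.single e 1 : σ →₀ ℕ).support
        (Finsupp.single f 1 : σ →₀ ℕ).support := by
      rw [Finsupp.support_single _ one_ne_zero, Finsupp.support_single _ one_ne_zero]
      simpa using hef
    rw [h, coeff_zero, Finsupp.support_add_eq h2, Finset.sum_union h2,
      Finsupp.support_single _ one_ne_zero, Finsupp.support_single _ one_ne_zero,
      Finset.sum_singleton, Finset.sum_singleton,
      add_tsub_cancel_left, add_tsub_cancel_right] at h1
    exact h1.symm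

/-- The linear syzygies with values in a subspace `W` of an `R`-module, viewed as the families
`h` in `W` indexed by the variables with `∑ X e • h e = 0`. -/
def linSyz (σ : Type*) {M : Type*} [Fintype σ] [AddCommGroup M] [Module K M] [Module (MvPolynomial σ K) M]
    [IsScalarTower K (MvPolynomial σ K) M] (W : Submodule K M) : Submodule K (σ → M) where
  carrier := {h | (∀ e, h e ∈ W) ∧ ∑ e, (X e : MvPolynomial σ K) • h e = 0}
  add_mem' hv hw := ⟨fun e => W.add_mem (hv.1 e) (hw.1 e), by
    simp [Finset.sum_add_distrib, hv.2, hw.2]⟩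
  zero_mem' := ⟨fun e => W.zero_mem, by simp⟩
  smul_mem' a v hv := ⟨fun e => W.smul_mem _ (hv.1 e), by
    have h : ∀ x : M, a • x = (C a : MvPolynomial σ K) • x := fun x => by
      rw [← algebraMap_eq, algebraMap_smul]
    simp only [Pi.smul_apply, h]
    simp_rw [smul_comm _ (C a : MvPolynomial σ K)]
    rw [← Finset.smul_sum, hv.2, smul_zero]⟩

end LinearSyzygies

/-- A graded submodule `sub` of `⊕ R(-deg c)` contained in the irrelevant ideal times it. -/
structure GradedStage (σ K : Type*) [Field K] where
  rank : ℕ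
  deg : Fin rank → ℕ
  sub : Submodule (MvPolynomial σ K) (Fin rank → MvPolynomial σ K)
  graded : IsGradedSubmodule deg sub
  irrelevant : ∀ v ∈ sub, ∀ c, coeff 0 (v c) = 0

namespace GradedStage

variable {σ K : Type*} [Field K]

/-- The degree `j` part of the submodule. -/
noncomputable def homPart (S : GradedStage σ K) (j : ℕ) : Submodule K (Fin S.rank → MvPolynomial σ K) :=
  S.sub.restrictScalars K ⊓ gradedPart S.deg j

/-- The submodule has no nonzero elements in degrees below `j`. -/
def StartsAt (S : GradedStage σ K) (j : ℕ) : Prop := ∀ i < j, S.homPart i = ⊥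

section Basic

variable {S : GradedStage σ K}

theorem apply_eq_zero_of_mem_homPart {j : ℕ} {v : Fin S.rank → MvPolynomial σ K}
    (hv : v ∈ S.homPart j) (c : Fin S.rank) (hc : j ≤ S.deg c) : v c = 0 := by
  rcases hc.lt_or_eq with h | h
  · exact (hv.2 c).2 h
  · have h1 := (hv.2 c).1 h.ge
    rw [h, Nat.sub_self] at h1
    rw [h1.eq_C_coeff_zero, S.irrelevant v hv.1, C_0]

theorem startsAt_of_le_deg {j : ℕ} (h : ∀ c, j ≤ S.deg c) : S.StartsAt (j + 1) := by
  intro i hi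
  rw [eq_bot_iff]
  intro v hv
  exact funext fun c => apply_eq_zero_of_mem_homPart hv c (by have := h c; omega)

theorem StartsAt.succ {j : ℕ} (h : S.StartsAt j) (h' : S.homPart j = ⊥) : S.StartsAt (j + 1) := by
  intro i hi
  rcases (Nat.lt_succ_iff.1 hi).lt_or_eq with h1 | rfl
  · exact h i h1
  · exact h'

end Basic

variable [Finite σ]

/-- The submodule of syzygies of a minimal system of homogeneous generators. -/
noncomputable def next (S : GradedStage σ K) : GradedStage σ K where
  rank := S.graded.exists_minimal_generators.choose
  deg := S.graded.exists_minimal_generators.choose_spec.choose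
  sub := LinearMap.ker
    S.graded.exists_minimal_generators.choose_spec.choose_spec.choose.vecMulLinear
  graded := isGradedSubmodule_ker_vecMulLinear
    S.graded.exists_minimal_generators.choose_spec.choose_spec.choose_spec.1
  irrelevant := S.graded.exists_minimal_generators.choose_spec.choose_spec.choose_spec.2.2

/-- The matrix of the chosen minimal system of homogeneous generators. -/
noncomputable def mat (S : GradedStage σ K) :
    Matrix (Fin S.next.rank) (Fin S.rank) (MvPolynomial σ K) :=
  S.graded.exists_minimal_generators.choose_spec.choose_spec.choose

variable (S : GradedStage σ K)

theorem mat_mem_gradedPart (k : Fin S.next.rank) : S.mat k ∈ gradedPart S.deg (S.next.deg k) :=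
  S.graded.exists_minimal_generators.choose_spec.choose_spec.choose_spec.1 k

theorem range_mat : LinearMap.range S.mat.vecMulLinear = S.sub :=
  S.graded.exists_minimal_generators.choose_spec.choose_spec.choose_spec.2.1

theorem next_sub : S.next.sub = LinearMap.ker S.mat.vecMulLinear := rfl

theorem mem_next_sub {v : Fin S.next.rank → MvPolynomial σ K} :
    v ∈ S.next.sub ↔ ∑ k, v k • S.mat k = 0 := by
  rw [next_sub, LinearMap.mem_ker, Matrix.vecMulLinear_apply, Matrix.vecMul_eq_sum]

theorem mem_sub_iff {v : Fin S.rank → MvPolynomial σ K} :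
    v ∈ S.sub ↔ ∃ w : Fin S.next.rank → MvPolynomial σ K, Matrix.vecMul w S.mat = v := by
  rw [← range_mat]; rfl

theorem mat_mem_sub (k : Fin S.next.rank) : S.mat k ∈ S.sub := by
  rw [mem_sub_iff]
  exact ⟨Pi.single k 1, by rw [Matrix.single_one_vecMul]; rfl⟩

theorem mat_ne_zero (k : Fin S.next.rank) : S.mat k ≠ 0 := fun h => by
  have h1 : (Pi.single k 1 : Fin S.next.rank → MvPolynomial σ K) ∈ S.next.sub := by
    rw [next_sub, LinearMap.mem_ker, Matrix.vecMulLinear_apply, Matrix.single_one_vecMul]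
    exact h
  have h2 := S.next.irrelevant _ h1 k
  simp at h2

theorem smul_const_injective (b : Fin S.next.rank → K) (h : ∑ k, b k • S.mat k = 0) : b = 0 := by
  have h1 : (fun k => C (b k) : Fin S.next.rank → MvPolynomial σ K) ∈ S.next.sub := by
    rw [mem_next_sub, ← h]
    refine Finset.sum_congr rfl fun k _ => ?_
    ext1 c
    rw [Pi.smul_apply, Pi.smul_apply, smul_eq_C_mul, smul_eq_mul]
  ext k
  simpa using S.next.irrelevant _ h1 k

theorem mat_mem_homPart (k : Fin S.next.rank) : S.mat k ∈ S.homPart (S.next.deg k) :=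
  ⟨S.mat_mem_sub k, S.mat_mem_gradedPart k⟩

variable {S}

theorem StartsAt.le_deg {j : ℕ} (h : S.StartsAt j) (k : Fin S.next.rank) : j ≤ S.next.deg k := by
  by_contra! hk
  have h1 := S.mat_mem_homPart k
  rw [h _ hk] at h1
  exact S.mat_ne_zero k h1

theorem StartsAt.next {j : ℕ} (h : S.StartsAt j) : S.next.StartsAt (j + 1) :=
  startsAt_of_le_deg h.le_deg

theorem StartsAt.exists_coeffs {j : ℕ} (h : S.StartsAt j) {v : Fin S.rank → MvPolynomial σ K}
    (hv : v ∈ S.homPart j) : ∃ b : Fin S.next.rank → K,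
      (∀ k, S.next.deg k ≠ j → b k = 0) ∧ ∑ k, b k • S.mat k = v := by
  obtain ⟨w, hw⟩ := S.mem_sub_iff.1 hv.1
  have h1 := gradedComp_vecMul S.mat_mem_gradedPart j w
  rw [hw, gradedComp_of_mem hv.2] at h1
  refine ⟨fun k => if S.next.deg k = j then coeff 0 (w k) else 0, fun k hk => if_neg hk, ?_⟩
  rw [h1, Matrix.vecMul_eq_sum]
  refine Finset.sum_congr rfl fun k _ => ?_
  ext1 c
  rw [gradedComp_apply, Pi.smul_apply, Pi.smul_apply, smul_eq_C_mul, smul_eq_mul]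
  congr 1
  by_cases hk : S.next.deg k = j
  · simp [hk, homogeneousComponent_zero]
  · simp only [if_neg hk]
    rw [if_neg (by have := h.le_deg k; omega), C_0]

theorem StartsAt.span_eq_homPart {j : ℕ} (h : S.StartsAt j) :
    Submodule.span K (Set.range fun k : {k // S.next.deg k = j} => S.mat k) = S.homPart j := by
  apply le_antisymm
  · rw [Submodule.span_le]
    rintro _ ⟨⟨k, rfl⟩, rfl⟩
    exact S.mat_mem_homPart k
  · intro v hv
    obtain ⟨b, hb, rfl⟩ := h.exists_coeffs hv
    refine Submodule.sum_mem _ fun k _ => ?_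
    by_cases hk : S.next.deg k = j
    · exact Submodule.smul_mem _ _ (Submodule.subset_span ⟨⟨k, hk⟩, rfl⟩)
    · rw [hb k hk, zero_smul]
      exact Submodule.zero_mem _

theorem StartsAt.card_deg_eq {j : ℕ} (h : S.StartsAt j) :
    (Finset.univ.filter fun k => S.next.deg k = j).card = Module.finrank K (S.homPart j) := by
  classical
  rw [← h.span_eq_homPart, finrank_span_eq_card, Fintype.card_subtype]
  have h1 : LinearIndependent K fun k => S.mat k :=
    Fintype.linearIndependent_iff.2 fun b hb k => congrFun (S.smul_const_injective b hb) k
  exact h1.comp _ Subtype.val_injective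

section LinearStrand

variable {σ K : Type*} [Field K] [Fintype σ] {S : GradedStage σ K}

/-- The linear coefficients of the entries of `v`, combined with the chosen generators. -/
noncomputable def linCoeff (S : GradedStage σ K) :
    (Fin S.next.rank → MvPolynomial σ K) →ₗ[K] (σ → Fin S.rank → MvPolynomial σ K) where
  toFun v e := ∑ k, coeff (Finsupp.single e 1) (v k) • S.mat k
  map_add' v w := by
    ext1 e
    simp only [Pi.add_apply, coeff_add, add_smul, Finset.sum_add_distrib]
  map_smul' a v := by
    ext1 e
    simp only [Pi.smul_apply, coeff_smul, smul_assoc, Finset.smul_sum, RingHom.id_apply]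

theorem linCoeff_apply (v : Fin S.next.rank → MvPolynomial σ K) (e : σ) :
    S.linCoeff v e = ∑ k, coeff (Finsupp.single e 1) (v k) • S.mat k := rfl

theorem sum_X_smul_linCoeff {v : Fin S.next.rank → MvPolynomial σ K}
    (hv : ∀ k, (v k).IsHomogeneous 1) :
    ∑ e, (X e : MvPolynomial σ K) • S.linCoeff v e = ∑ k, v k • S.mat k := by
  simp_rw [linCoeff_apply, Finset.smul_sum]
  rw [Finset.sum_comm]
  refine Finset.sum_congr rfl fun k _ => ?_
  conv_rhs => rw [(hv k).eq_sum_coeff_single, Finset.sum_smul]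
  refine Finset.sum_congr rfl fun e _ => ?_
  ext1 c
  simp only [Pi.smul_apply, smul_eq_C_mul, smul_eq_mul]
  ring

theorem StartsAt.apply_homPart_succ {j : ℕ} (h : S.StartsAt j)
    {v : Fin S.next.rank → MvPolynomial σ K} (hv : v ∈ S.next.homPart (j + 1))
    (k : Fin S.next.rank) : (v k).IsHomogeneous 1 ∧ (S.next.deg k ≠ j → v k = 0) := by
  by_cases hk : S.next.deg k = j
  · refine ⟨?_, fun h => (h hk).elim⟩
    have h1 := (hv.2 k).1 (by omega)
    rwa [hk, Nat.add_sub_cancel_left] at h1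
  · have h1 : v k = 0 := apply_eq_zero_of_mem_homPart hv k (by have := h.le_deg k; omega)
    rw [h1]
    exact ⟨isHomogeneous_zero _ _ _, fun _ => rfl⟩

theorem StartsAt.linCoeff_mem {j : ℕ} (h : S.StartsAt j)
    {v : Fin S.next.rank → MvPolynomial σ K} (hv : v ∈ S.next.homPart (j + 1)) :
    S.linCoeff v ∈ linSyz σ (S.homPart j) := by
  refine ⟨fun e => ?_, ?_⟩
  · rw [linCoeff_apply]
    refine Submodule.sum_mem _ fun k _ => ?_
    by_cases hk : S.next.deg k = j
    · exact Submodule.smul_mem _ _ (hk ▸ S.mat_mem_homPart k)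
    · rw [(h.apply_homPart_succ hv k).2 hk, coeff_zero, zero_smul]
      exact Submodule.zero_mem _
  · rw [sum_X_smul_linCoeff fun k => (h.apply_homPart_succ hv k).1]
    exact (S.mem_next_sub).1 hv.1

theorem StartsAt.eq_zero_of_linCoeff_eq_zero {j : ℕ} (h : S.StartsAt j)
    {v : Fin S.next.rank → MvPolynomial σ K} (hv : v ∈ S.next.homPart (j + 1))
    (h0 : S.linCoeff v = 0) : v = 0 := by
  ext1 k
  rw [(h.apply_homPart_succ hv k).1.eq_sum_coeff_single]
  refine Finset.sum_eq_zero fun e _ => ?_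
  have h1 := S.smul_const_injective _ (congrFun h0 e)
  rw [congrFun h1 k, Pi.zero_apply, C_0, zero_mul]

theorem StartsAt.exists_linCoeff_eq {j : ℕ} (h : S.StartsAt j)
    {g : σ → Fin S.rank → MvPolynomial σ K} (hg : g ∈ linSyz σ (S.homPart j)) :
    ∃ v ∈ S.next.homPart (j + 1), S.linCoeff v = g := by
  classical
  choose b hb hbg using fun e => h.exists_coeffs (hg.1 e)
  let v : Fin S.next.rank → MvPolynomial σ K := fun k => ∑ e, C (b e k) * X e
  have hv : ∀ k, (v k).IsHomogeneous 1 := fun k =>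
    IsHomogeneous.sum _ _ _ fun e _ => isHomogeneous_C_mul_X _ _
  have hcoeff : S.linCoeff v = g := by
    ext1 e
    rw [linCoeff_apply, ← hbg e]
    refine Finset.sum_congr rfl fun k _ => ?_
    congr 1
    simp only [v, coeff_sum, coeff_C_mul, coeff_X]
    rw [Finset.sum_eq_single e]
    · simp
    · intro f _ hf
      rw [if_neg fun h => hf (Finsupp.single_left_injective one_ne_zero h), mul_zero]
    · simp
  refine ⟨v, ⟨?_, fun k => ?_⟩, hcoeff⟩
  · show v ∈ S.next.sub
    rw [mem_next_sub, ← sum_X_smul_linCoeff hv, hcoeff, hg.2]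
  · by_cases hk : S.next.deg k = j
    · rw [hk]
      exact ⟨fun _ => by rw [Nat.add_sub_cancel_left]; exact hv k, fun _ => by omega⟩
    · have h1 : v k = 0 := Finset.sum_eq_zero fun e _ => by rw [hb e k hk, C_0, zero_mul]
      rw [h1]
      exact ⟨fun _ => isHomogeneous_zero _ _ _, fun _ => rfl⟩

theorem StartsAt.finrank_homPart_next {j : ℕ} (h : S.StartsAt j) :
    Module.finrank K (S.next.homPart (j + 1)) = Module.finrank K (linSyz σ (S.homPart j)) := by
  refine LinearEquiv.finrank_eq (LinearEquiv.ofBijective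
    (S.linCoeff.restrict fun v hv => h.linCoeff_mem hv) ⟨?_, ?_⟩)
  · rw [← LinearMap.ker_eq_bot, LinearMap.ker_eq_bot']
    intro v hv
    exact Subtype.ext (h.eq_zero_of_linCoeff_eq_zero v.2 (congrArg Subtype.val hv))
  · intro g
    obtain ⟨v, hv, hvg⟩ := h.exists_linCoeff_eq g.2
    exact ⟨⟨v, hv⟩, Subtype.ext hvg⟩

/-- If there are no nonzero alternating families of linear syzygies, then there are no linear
second syzygies. -/
theorem StartsAt.homPart_next_next {j : ℕ} (h : S.StartsAt j)
    (hs : ∀ s : σ → σ → Fin S.rank → MvPolynomial σ K, (∀ f, s f ∈ linSyz σ (S.homPart j)) →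
      (∀ e f, s e f + s f e = 0) → (∀ e, s e e = 0) → s = 0) :
    S.next.next.homPart (j + 2) = ⊥ := by
  classical
  rw [eq_bot_iff]
  intro v hv
  rw [Submodule.mem_bot]
  refine h.next.eq_zero_of_linCoeff_eq_zero hv ?_
  obtain ⟨hg, hg0⟩ := h.next.linCoeff_mem hv
  set g := S.next.linCoeff v
  have hrel : ∀ k, ∑ f, X f * g f k = 0 := fun k => by
    have h1 := congrFun hg0 k
    rwa [Finset.sum_apply] at h1
  have h0 := hs (fun f => S.linCoeff (g f)) (fun f => h.linCoeff_mem (hg f))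
    (fun e f => by
      rw [linCoeff_apply, linCoeff_apply, ← Finset.sum_add_distrib]
      refine Finset.sum_eq_zero fun k _ => ?_
      rw [← add_smul, coeff_add_coeff_of_sum_X_mul_eq_zero (fun f => g f k) (hrel k), zero_smul])
    (fun e => by
      rw [linCoeff_apply]
      refine Finset.sum_eq_zero fun k _ => ?_
      rw [coeff_self_of_sum_X_mul_eq_zero (fun f => g f k) (hrel k), zero_smul])
  refine funext fun f => ?_
  have h1 : S.linCoeff (g f) = 0 := congrFun h0 f
  have h2 := hg f
  generalize g f = w at h1 h2
  exact h.eq_zero_of_linCoeff_eq_zero h2 h1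

end LinearStrand

end GradedStage

section LinSyzMap

variable {σ K M τ : Type*} [Field K] [Fintype σ] [Fintype τ] [AddCommGroup M] [Module K M]
  [Module (MvPolynomial σ K) M] [IsScalarTower K (MvPolynomial σ K) M]

/-- The map sending the coefficients `a` to `∑ e, X e • ∑ T, a e T • b T`. -/
noncomputable def linSyzMap (K σ : Type*) [Field K] [Fintype σ] [Module K M]
    [Module (MvPolynomial σ K) M]
    [IsScalarTower K (MvPolynomial σ K) M] (b : τ → M) : (σ → τ → K) →ₗ[K] M where
  toFun a := ∑ e, (X e : MvPolynomial σ K) • ∑ T, a e T • b T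
  map_add' x y := by
    simp only [Pi.add_apply, add_smul, Finset.sum_add_distrib, smul_add]
  map_smul' t x := by
    have h : ∀ x : M, t • x = (C t : MvPolynomial σ K) • x := fun x => by
      rw [← algebraMap_eq, algebraMap_smul]
    simp only [Pi.smul_apply, smul_assoc, ← Finset.smul_sum, RingHom.id_apply]
    simp only [h, smul_comm _ (C t : MvPolynomial σ K)]
    rw [← Finset.smul_sum]

theorem linSyzMap_apply (b : τ → M) (a : σ → τ → K) :
    linSyzMap K σ b a = ∑ e, (X e : MvPolynomial σ K) • ∑ T, a e T • b T := rfl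

theorem sum_smul_mem_linSyz {b : τ → M} {a : σ → τ → K} (ha : a ∈ LinearMap.ker (linSyzMap K σ b)) :
    (fun e => ∑ T, a e T • b T : σ → M) ∈ linSyz σ (Submodule.span K (Set.range b)) :=
  ⟨fun _ => Submodule.sum_mem _ fun T _ =>
    Submodule.smul_mem _ _ (Submodule.subset_span ⟨T, rfl⟩), ha⟩

theorem exists_sum_smul_of_mem_linSyz {b : τ → M} {h : σ → M}
    (hh : h ∈ linSyz σ (Submodule.span K (Set.range b))) :
    ∃ a ∈ LinearMap.ker (linSyzMap K σ b), (fun e => ∑ T, a e T • b T) = h := by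
  choose a ha using fun e => (Submodule.mem_span_range_iff_exists_fun K).1 (hh.1 e)
  refine ⟨a, ?_, funext ha⟩
  rw [LinearMap.mem_ker, linSyzMap_apply, ← hh.2]
  exact Finset.sum_congr rfl fun e _ => by rw [ha]

theorem finrank_linSyz_span {b : τ → M} (hb : LinearIndependent K b) :
    Module.finrank K (linSyz σ (Submodule.span K (Set.range b))) =
      Module.finrank K (LinearMap.ker (linSyzMap K σ b)) := by
  symm
  let Φ : (σ → τ → K) →ₗ[K] (σ → M) :=
    LinearMap.pi fun e => (Fintype.linearCombination K b).comp (LinearMap.proj e)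
  refine LinearEquiv.finrank_eq (LinearEquiv.ofBijective
    (Φ.restrict fun a ha => sum_smul_mem_linSyz ha) ⟨?_, ?_⟩)
  · rw [← LinearMap.ker_eq_bot, LinearMap.ker_eq_bot']
    intro a ha
    refine Subtype.ext (funext fun e => funext fun T => ?_)
    exact Fintype.linearIndependent_iff.1 hb _ (congrFun (congrArg Subtype.val ha) e) T
  · intro h
    obtain ⟨a, ha, hah⟩ := exists_sum_smul_of_mem_linSyz h.2
    exact ⟨⟨a, ha⟩, Subtype.ext hah⟩

theorem ker_linSyzMap_const {κ : Type*} [Nonempty κ] (b : τ → MvPolynomial σ K) :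
    LinearMap.ker (linSyzMap K σ fun T => (fun _ : κ => b T)) =
      LinearMap.ker (linSyzMap K σ b) := by
  ext a
  rw [LinearMap.mem_ker, LinearMap.mem_ker, linSyzMap_apply, linSyzMap_apply]
  refine ⟨fun h => ?_, fun h => funext fun c => ?_⟩
  · simpa only [Finset.sum_apply, Pi.smul_apply, Pi.zero_apply] using
      congrFun h (Classical.arbitrary κ)
  · simpa only [Finset.sum_apply, Pi.smul_apply, Pi.zero_apply] using h

theorem eq_zero_of_alternating_linSyz {b : τ → M} (hb : LinearIndependent K b)
    (halt : ∀ s : σ → σ → τ → K, (∀ f, s f ∈ LinearMap.ker (linSyzMap K σ b)) →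
      (∀ e f, s e f + s f e = 0) → (∀ e, s e e = 0) → s = 0)
    (s : σ → σ → M) (hs : ∀ f, s f ∈ linSyz σ (Submodule.span K (Set.range b)))
    (h1 : ∀ e f, s e f + s f e = 0) (h2 : ∀ e, s e e = 0) : s = 0 := by
  choose a ha hah using fun f => exists_sum_smul_of_mem_linSyz (hs f)
  have hah' : ∀ f e, ∑ T, a f e T • b T = s f e := fun f e => congrFun (hah f) e
  rw [Fintype.linearIndependent_iff] at hb
  have h := halt a ha
    (fun e f => funext fun T => hb _ (by
      simp only [Pi.add_apply, add_smul, Finset.sum_add_distrib, hah', h1]) T)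
    (fun e => funext fun T => hb _ (by rw [hah', h2]) T)
  funext f e
  simp [← hah', h]

end LinSyzMap

section Resolution

variable {σ K : Type*} [Field K]

theorem homogeneousComponent_mem_span {G : Set (MvPolynomial σ K)}
    (hG : ∀ g ∈ G, ∃ d, g.IsHomogeneous d) {p : MvPolynomial σ K} (hp : p ∈ Ideal.span G) (j : ℕ) :
    homogeneousComponent j p ∈ Ideal.span G := by
  suffices h : ∀ r, homogeneousComponent j (r * p) ∈ Ideal.span G by simpa using h 1
  induction hp using Submodule.span_induction with
  | mem g hg =>
    intro r
    obtain ⟨d, hd⟩ := hG g hg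
    rw [homogeneousComponent_mul_of_isHomogeneous hd]
    split_ifs
    · exact Ideal.mul_mem_left _ _ (Ideal.subset_span hg)
    · exact Ideal.zero_mem _
  | zero => simp
  | add x y _ _ hx hy => intro r; rw [mul_add, map_add]; exact Ideal.add_mem _ (hx r) (hy r)
  | smul a x _ hx => intro r; rw [smul_eq_mul, ← mul_assoc]; exact hx _

theorem homogeneousComponent_of_mem_span_of_lt {G : Set (MvPolynomial σ K)} {m : ℕ}
    (hG : ∀ g ∈ G, ∃ d, m ≤ d ∧ g.IsHomogeneous d) {p : MvPolynomial σ K}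
    (hp : p ∈ Ideal.span G) {j : ℕ} (hj : j < m) : homogeneousComponent j p = 0 := by
  suffices h : ∀ r, homogeneousComponent j (r * p) = 0 by simpa using h 1
  induction hp using Submodule.span_induction with
  | mem g hg =>
    intro r
    obtain ⟨d, hmd, hd⟩ := hG g hg
    rw [homogeneousComponent_mul_of_isHomogeneous hd, if_neg (by omega)]
  | zero => simp
  | add x y _ _ hx hy => intro r; rw [mul_add, map_add, hx, hy, add_zero]
  | smul a x _ hx => intro r; rw [smul_eq_mul, ← mul_assoc]; exact hx _

theorem homogeneousComponent_mem_span_of_generators {G : Set (MvPolynomial σ K)} {m : ℕ}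
    (hG : ∀ g ∈ G, ∃ d, m ≤ d ∧ g.IsHomogeneous d) {W : Submodule K (MvPolynomial σ K)}
    (hW : ∀ g ∈ G, g.IsHomogeneous m → g ∈ W) {p : MvPolynomial σ K}
    (hp : p ∈ Ideal.span G) : homogeneousComponent m p ∈ W := by
  suffices h : ∀ r, homogeneousComponent m (r * p) ∈ W by simpa using h 1
  induction hp using Submodule.span_induction with
  | mem g hg =>
    intro r
    obtain ⟨d, hmd, hd⟩ := hG g hg
    rw [homogeneousComponent_mul_of_isHomogeneous hd]
    split_ifs with h
    · obtain rfl : d = m := le_antisymm h hmd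
      rw [Nat.sub_self, homogeneousComponent_zero, ← smul_eq_C_mul]
      exact W.smul_mem _ (hW g hg hd)
    · exact W.zero_mem
  | zero => simp
  | add x y _ _ hx hy => intro r; rw [mul_add, map_add]; exact W.add_mem (hx r) (hy r)
  | smul a x _ hx => intro r; rw [smul_eq_mul, ← mul_assoc]; exact hx _

namespace GradedStage

/-- A homogeneous ideal in the irrelevant ideal, as a graded submodule of `R`. -/
noncomputable def ofIdeal (I : Ideal (MvPolynomial σ K))
    (h1 : ∀ p ∈ I, ∀ j, homogeneousComponent j p ∈ I) (h2 : ∀ p ∈ I, coeff 0 p = 0) :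
    GradedStage σ K where
  rank := 1
  deg _ := 0
  sub := Submodule.pi Set.univ fun _ => (I : Submodule (MvPolynomial σ K) (MvPolynomial σ K))
  graded := fun v hv j c _ => by
    rw [gradedComp_apply, if_pos (Nat.zero_le _)]
    exact h1 _ (hv c trivial) _
  irrelevant := fun v hv c => h2 _ (hv c trivial)

theorem mem_homPart_ofIdeal {I : Ideal (MvPolynomial σ K)}
    (h1 : ∀ p ∈ I, ∀ j, homogeneousComponent j p ∈ I) (h2 : ∀ p ∈ I, coeff 0 p = 0) {j : ℕ}
    {v : Fin 1 → MvPolynomial σ K} :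
    v ∈ (ofIdeal I h1 h2).homPart j ↔ v 0 ∈ I ∧ (v 0).IsHomogeneous j := by
  refine ⟨fun h => ⟨h.1 (0 : Fin 1) trivial, (h.2 (0 : Fin 1)).1 (Nat.zero_le _)⟩,
    fun h => ⟨fun (c : Fin 1) _ => ?_, fun (c : Fin 1) => ?_⟩⟩
  · rw [Subsingleton.elim c 0]; exact h.1
  · rw [Subsingleton.elim c 0]; exact ⟨fun _ => h.2, fun h => absurd h (Nat.not_lt_zero _)⟩

variable [Fintype σ]

/-- The stages of the minimal free resolution starting from `S`. -/
noncomputable def iter (S : GradedStage σ K) : ℕ → GradedStage σ K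
  | 0 => S
  | i + 1 => (iter S i).next

/-- The graded minimal free resolution obtained by iterating `GradedStage.next`. -/
noncomputable def resolution (I : Ideal (MvPolynomial σ K))
    (h1 : ∀ p ∈ I, ∀ j, homogeneousComponent j p ∈ I) (h2 : ∀ p ∈ I, coeff 0 p = 0) :
    MinGradedFreeRes K σ I :=
  let S := (ofIdeal I h1 h2).iter
  have hmin : ∀ i r c, coeff 0 ((S i).mat r c) = 0 := fun i r c =>
    (S i).irrelevant _ ((S i).mat_mem_sub r) c
  have hex : ∀ i, LinearMap.range (S (i + 1)).mat.vecMulLinear =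
      LinearMap.ker (S i).mat.vecMulLinear := fun i => (S (i + 1)).range_mat
  { len := Fintype.card σ
    rk := fun i => (S i).rank
    rk_zero := rfl
    rk_eventually_zero := MvPolynomial.hasSyzygyBound K σ _ (fun i => (S i).mat)
      (fun i r c => by rw [constantCoeff_eq]; exact hmin i r c) hex
    deg := fun i => (S i).deg
    deg_zero := fun _ => rfl
    mat := fun i => (S i).mat
    homog := fun i r c => by
      have h := (S i).mat_mem_gradedPart r c
      rcases le_or_gt ((S i).deg c) ((S (i + 1)).deg r) with hd | hd
      · exact h.1 hd
      · rw [h.2 hd]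
        exact isHomogeneous_zero _ _ _
    minimal := hmin
    exact := hex
    aug := (S 0).range_mat }

theorem StartsAt.linear_strand {τ : Type*} [Fintype τ] {S : GradedStage σ K}
    [Nonempty (Fin S.rank)] {j : ℕ} (hS : S.StartsAt j) {b : τ → MvPolynomial σ K}
    (hb : LinearIndependent K b)
    (hSb : S.homPart j = Submodule.span K (Set.range fun T => (fun _ : Fin S.rank => b T)))
    (halt : ∀ s : σ → σ → τ → K, (∀ f, s f ∈ LinearMap.ker (linSyzMap K σ b)) →
      (∀ e f, s e f + s f e = 0) → (∀ e, s e e = 0) → s = 0) :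
    (Finset.univ.filter fun r => (S.iter 1).deg r = j).card = Fintype.card τ ∧
      (Finset.univ.filter fun r => (S.iter 2).deg r = j + 1).card =
        Module.finrank K (LinearMap.ker (linSyzMap K σ b)) ∧
      ∀ i, (Finset.univ.filter fun r => (S.iter (i + 3)).deg r = j + 2 + i).card = 0 := by
  have hb' : LinearIndependent K fun T => (fun _ : Fin S.rank => b T) := by
    rw [Fintype.linearIndependent_iff] at hb ⊢
    intro c hc
    refine hb c ?_
    simpa only [Finset.sum_apply, Pi.smul_apply, Pi.zero_apply] using
      congrFun hc (Classical.arbitrary (Fin S.rank))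
  refine ⟨?_, ?_, fun i => ?_⟩
  · refine hS.card_deg_eq.trans ?_
    rw [hSb, finrank_span_eq_card hb']
  · refine hS.next.card_deg_eq.trans ?_
    rw [hS.finrank_homPart_next, hSb, finrank_linSyz_span hb', ker_linSyzMap_const]
  · have hS2 : S.next.next.StartsAt (j + 3) := by
      refine hS.next.next.succ (hS.homPart_next_next fun s hs => ?_)
      rw [hSb] at hs
      refine eq_zero_of_alternating_linSyz hb' ?_ s hs
      rwa [ker_linSyzMap_const]
    have h : ∀ k, (S.iter (k + 2)).StartsAt (j + 3 + k) := fun k => by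
      induction k with
      | zero => exact hS2
      | succ k ih => exact ih.next
    rw [Finset.card_eq_zero, Finset.filter_eq_empty_iff]
    intro r _ hr
    have h3 := (h i).le_deg r
    have h4 : (S.iter (i + 2)).next.deg r = j + 2 + i := hr
    omega

end GradedStage

/-- The linear strand of an ideal generated by homogeneous elements of degree at least two, whose
quadrics have the basis `b`. -/
theorem exists_minGradedFreeRes_of_span [Fintype σ] {τ : Type*} [Fintype τ]
    {G : Set (MvPolynomial σ K)} (hG : ∀ g ∈ G, ∃ d, 2 ≤ d ∧ g.IsHomogeneous d)
    {b : τ → MvPolynomial σ K} (hb : LinearIndependent K b)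
    (hbG : ∀ T, b T ∈ Ideal.span G ∧ (b T).IsHomogeneous 2)
    (hGb : ∀ g ∈ G, g.IsHomogeneous 2 → g ∈ Submodule.span K (Set.range b))
    (halt : ∀ s : σ → σ → τ → K, (∀ f, s f ∈ LinearMap.ker (linSyzMap K σ b)) →
      (∀ e f, s e f + s f e = 0) → (∀ e, s e e = 0) → s = 0) :
    ∃ res : MinGradedFreeRes K σ (Ideal.span G),
      (Finset.univ.filter fun r => res.deg 1 r = 2).card = Fintype.card τ ∧
      (Finset.univ.filter fun r => res.deg 2 r = 3).card =
        Module.finrank K (LinearMap.ker (linSyzMap K σ b)) ∧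
      ∀ i, 3 ≤ i → (Finset.univ.filter fun r => res.deg i r = i + 1).card = 0 := by
  have h1 : ∀ p ∈ Ideal.span G, ∀ j, homogeneousComponent j p ∈ Ideal.span G := fun p hp j =>
    homogeneousComponent_mem_span (fun g hg => (hG g hg).imp fun _ h => h.2) hp j
  have h2 : ∀ p ∈ Ideal.span G, coeff 0 p = 0 := fun p hp => by
    have h := homogeneousComponent_of_mem_span_of_lt hG hp (j := 0) (by norm_num)
    rwa [homogeneousComponent_zero, C_eq_zero] at h
  have : Nonempty (Fin (GradedStage.ofIdeal (Ideal.span G) h1 h2).rank) := ⟨(0 : Fin 1)⟩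
  have hS : (GradedStage.ofIdeal (Ideal.span G) h1 h2).StartsAt 2 := by
    intro j hj
    rw [eq_bot_iff]
    intro v hv
    obtain ⟨hv1, hv2⟩ := (GradedStage.mem_homPart_ofIdeal h1 h2).1 hv
    rw [Submodule.mem_bot]
    refine funext fun (c : Fin 1) => ?_
    rw [Subsingleton.elim c 0]
    have h := homogeneousComponent_of_mem_span_of_lt hG hv1 hj
    rwa [homogeneousComponent_eq_self hv2] at h
  have hSb : (GradedStage.ofIdeal (Ideal.span G) h1 h2).homPart 2 =
      Submodule.span K (Set.range fun T =>
        (fun _ : Fin (GradedStage.ofIdeal (Ideal.span G) h1 h2).rank => b T)) := by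
    apply le_antisymm
    · intro v hv
      obtain ⟨hv1, hv2⟩ := (GradedStage.mem_homPart_ofIdeal h1 h2).1 hv
      have h := homogeneousComponent_mem_span_of_generators hG hGb hv1
      rw [homogeneousComponent_eq_self hv2, Submodule.mem_span_range_iff_exists_fun] at h
      obtain ⟨c, hc⟩ := h
      refine (Submodule.mem_span_range_iff_exists_fun K).2 ⟨c, funext fun (i : Fin 1) => ?_⟩
      rw [Subsingleton.elim i 0, ← hc]
      exact Finset.sum_apply (0 : Fin 1) Finset.univ fun T => c T • fun _ : Fin 1 => b T
    · rw [Submodule.span_le]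
      rintro _ ⟨T, rfl⟩
      exact (GradedStage.mem_homPart_ofIdeal h1 h2).2 (hbG T)
  obtain ⟨h3, h4, h5⟩ := hS.linear_strand hb hSb halt
  refine ⟨GradedStage.resolution _ h1 h2, h3, h4, fun i hi => ?_⟩
  obtain ⟨k, rfl⟩ : ∃ k, i = k + 3 := ⟨i - 3, by omega⟩
  rw [show k + 3 + 1 = 2 + 2 + k by omega]
  exact h5 k

end Resolution

section OTGenerators

variable {K ι : Type*} [Field K] [Fintype ι]

theorem mem_vsupp {c : ι → K} {j : ι} : j ∈ vsupp c ↔ c j ≠ 0 := by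
  simp [vsupp]

variable [DecidableEq ι]

theorem otgen_isHomogeneous (c : ι → K) : (otgen c).IsHomogeneous ((vsupp c).card - 1) := by
  refine IsHomogeneous.sum _ _ _ fun j hj => ?_
  have h := IsHomogeneous.prod ((vsupp c).erase j) (fun l => (X l : MvPolynomial ι K))
    (fun _ => 1) fun l _ => isHomogeneous_X K l
  rw [Finset.sum_const, Finset.card_erase_of_mem hj, smul_eq_mul, mul_one] at h
  exact h.C_mul _

theorem otgen_eq_of_vsupp_eq {c : ι → K} {e f g : ι} (hef : e ≠ f) (heg : e ≠ g) (hfg : f ≠ g)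
    (h : vsupp c = {e, f, g}) :
    otgen c = C (c e) * (X f * X g) + C (c f) * (X g * X e) + C (c g) * (X e * X f) := by
  have h1 : ({e, f, g} : Finset ι).erase e = {f, g} := by grind
  have h2 : ({e, f, g} : Finset ι).erase f = {g, e} := by grind
  have h3 : ({e, f, g} : Finset ι).erase g = {e, f} := by grind
  unfold otgen
  rw [h, Finset.sum_insert (by simp [hef, heg]), Finset.sum_insert (by simp [hfg]),
    Finset.sum_singleton, h1, h2, h3, Finset.prod_pair hfg, Finset.prod_pair heg.symm,
    Finset.prod_pair hef, add_assoc]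

end OTGenerators

namespace GraphicOT

variable (K : Type*) [Field K] {V : Type*}

theorem quot_out_eq (u v : V) : Quot.out s(u, v) = (u, v) ∨ Quot.out s(u, v) = (v, u) := by
  have h : s((Quot.out s(u, v)).1, (Quot.out s(u, v)).2) = s(u, v) := Quot.out_eq _
  rcases Sym2.eq_iff.1 h with h | h
  · exact Or.inl (Prod.ext h.1 h.2)
  · exact Or.inr (Prod.ext h.1 h.2)

variable [DecidableEq V]

/-- The sign comparing the ordered pair `(u, v)` with the chosen orientation of `s(u, v)`. -/
noncomputable def sign (u v : V) : K := if (Quot.out s(u, v)).1 = u then 1 else -1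

theorem sign_swap {u v : V} (h : u ≠ v) : sign K v u = -sign K u v := by
  unfold sign
  rw [Sym2.eq_swap]
  rcases quot_out_eq u v with h1 | h1 <;> simp [h1, h, h.symm]

theorem sign_mul_self (u v : V) : sign K u v * sign K u v = 1 := by
  unfold sign
  split_ifs <;> simp

theorem sign_ne_zero (u v : V) : sign K u v ≠ 0 := fun h => by
  have := sign_mul_self K u v
  simp [h] at this

variable (G : SimpleGraph V)

theorem graphForm_apply {u v : V} (h : G.Adj u v) :
    graphForm K G ⟨s(u, v), h⟩ = sign K u v • (Pi.single u 1 - Pi.single v 1) := by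
  unfold graphForm sign
  rcases quot_out_eq u v with h1 | h1 <;> simp [h1, h.ne.symm]

/-- The type of triangles of `G`. -/
abbrev Triangle := {s : Finset V // G.IsNClique 3 s}

variable {G} in
theorem Triangle.exists_eq (T : Triangle G) : ∃ p : V × V × V, G.Adj p.1 p.2.1 ∧
    G.Adj p.1 p.2.2 ∧ G.Adj p.2.1 p.2.2 ∧ (T : Finset V) = {p.1, p.2.1, p.2.2} := by
  obtain ⟨u, v, w, h⟩ := SimpleGraph.is3Clique_iff.1 T.2
  exact ⟨(u, v, w), h⟩

variable [DecidableRel G.Adj]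

/-- The variable of the edge `uv` with the sign making it antisymmetric in `u` and `v`. -/
noncomputable def edgeVar (u v : V) : MvPolynomial G.edgeSet K :=
  if h : G.Adj u v then C (sign K u v) * X ⟨s(u, v), h⟩ else 0

theorem edgeVar_of_adj {u v : V} (h : G.Adj u v) :
    edgeVar K G u v = C (sign K u v) * X ⟨s(u, v), h⟩ := dif_pos h

theorem edgeVar_swap (u v : V) : edgeVar K G v u = -edgeVar K G u v := by
  by_cases h : G.Adj u v
  · rw [edgeVar_of_adj K G h, edgeVar_of_adj K G h.symm, sign_swap K h.ne]
    have h1 : (⟨s(v, u), h.symm⟩ : G.edgeSet) = ⟨s(u, v), h⟩ := Subtype.ext Sym2.eq_swap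
    rw [h1, C_neg, neg_mul]
  · rw [edgeVar, edgeVar, dif_neg h, dif_neg fun h1 => h h1.symm, neg_zero]

theorem X_eq_edgeVar {u v : V} (h : G.Adj u v) :
    (X ⟨s(u, v), h⟩ : MvPolynomial G.edgeSet K) = C (sign K u v) * edgeVar K G u v := by
  rw [edgeVar_of_adj K G h, ← mul_assoc, ← C_mul, sign_mul_self, C_1, one_mul]

theorem edgeVar_isHomogeneous (u v : V) : (edgeVar K G u v).IsHomogeneous 1 := by
  unfold edgeVar
  split_ifs
  · exact isHomogeneous_C_mul_X _ _
  · exact isHomogeneous_zero _ _ _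

/-- The quadric of the triangle `uvw`. -/
noncomputable def triangleQuadric (u v w : V) : MvPolynomial G.edgeSet K :=
  edgeVar K G u v * edgeVar K G v w + edgeVar K G v w * edgeVar K G w u +
    edgeVar K G w u * edgeVar K G u v

theorem triangleQuadric_rotate (u v w : V) :
    triangleQuadric K G v w u = triangleQuadric K G u v w := by
  unfold triangleQuadric; ring

theorem triangleQuadric_swap (u v w : V) :
    triangleQuadric K G v u w = triangleQuadric K G u v w := by
  unfold triangleQuadric
  rw [edgeVar_swap K G u v, edgeVar_swap K G v w, edgeVar_swap K G w u]
  ring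

theorem triangleQuadric_congr {u v w u' v' w' : V} (huv : u ≠ v) (huw : u ≠ w) (hvw : v ≠ w)
    (h : ({u, v, w} : Finset V) = {u', v', w'}) :
    triangleQuadric K G u v w = triangleQuadric K G u' v' w' := by
  have hu : u ∈ ({u', v', w'} : Finset V) := by rw [← h]; simp
  have hv : v ∈ ({u', v', w'} : Finset V) := by rw [← h]; simp
  have hw : w ∈ ({u', v', w'} : Finset V) := by rw [← h]; simp
  simp only [Finset.mem_insert, Finset.mem_singleton] at hu hv hw
  have h1 := triangleQuadric_rotate K G
  have h2 := triangleQuadric_swap K G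
  rcases hu with rfl | rfl | rfl <;> rcases hv with rfl | rfl | rfl <;>
    rcases hw with rfl | rfl | rfl <;> grind

theorem triangleQuadric_isHomogeneous (u v w : V) :
    (triangleQuadric K G u v w).IsHomogeneous 2 := by
  have h := edgeVar_isHomogeneous K G
  exact (((h u v).mul (h v w)).add ((h v w).mul (h w u))).add ((h w u).mul (h u v))

/-- The quadric of a triangle. -/
noncomputable def quadric (T : Triangle G) : MvPolynomial G.edgeSet K :=
  triangleQuadric K G T.exists_eq.choose.1 T.exists_eq.choose.2.1 T.exists_eq.choose.2.2

theorem quadric_eq {T : Triangle G} {u v w : V} (h : (T : Finset V) = {u, v, w}) :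
    quadric K G T = triangleQuadric K G u v w := by
  obtain ⟨h1, h2, h3, h4⟩ := T.exists_eq.choose_spec
  exact triangleQuadric_congr K G h1.ne h2.ne h3.ne (h4.symm.trans h)

theorem quadric_isHomogeneous (T : Triangle G) : (quadric K G T).IsHomogeneous 2 :=
  triangleQuadric_isHomogeneous _ _ _ _ _

section Coefficients

variable {K G}

theorem of_coeff_edgeVar_mul_ne_zero {u v u' v' : V} {e f : G.edgeSet}
    (h : coeff (Finsupp.single e 1 + Finsupp.single f 1)
      (edgeVar K G u v * edgeVar K G u' v') ≠ 0) :
    ((e : Sym2 V) = s(u, v) ∧ (f : Sym2 V) = s(u', v')) ∨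
      ((e : Sym2 V) = s(u', v') ∧ (f : Sym2 V) = s(u, v)) := by
  unfold edgeVar at h
  split_ifs at h with h1 h2
  · rw [mul_mul_mul_comm, ← C_mul, coeff_C_mul, X, X, monomial_mul, coeff_monomial] at h
    split_ifs at h with h3
    · rw [Finsupp.single_add_single_eq_single_add_single one_ne_zero one_ne_zero] at h3
      rcases h3 with ⟨rfl, rfl⟩ | ⟨_, rfl, rfl⟩ | ⟨h4, _⟩
      · exact Or.inl ⟨rfl, rfl⟩
      · exact Or.inr ⟨rfl, rfl⟩
      · norm_num at h4
    · simp at h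
  · simp at h
  · simp at h
  · simp at h

theorem coeff_edgeVar_mul_edgeVar {u v w : V} (huv : G.Adj u v) (hvw : G.Adj v w) :
    coeff (Finsupp.single (⟨s(u, v), huv⟩ : G.edgeSet) 1 + Finsupp.single ⟨s(v, w), hvw⟩ 1)
      (edgeVar K G u v * edgeVar K G v w) = sign K u v * sign K v w := by
  rw [edgeVar_of_adj K G huv, edgeVar_of_adj K G hvw, mul_mul_mul_comm, ← C_mul, coeff_C_mul,
    X, X, monomial_mul, coeff_monomial, if_pos rfl]
  ring

theorem of_coeff_quadric_ne_zero {T : Triangle G} {e f : G.edgeSet}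
    (h : coeff (Finsupp.single e 1 + Finsupp.single f 1) (quadric K G T) ≠ 0) :
    (e : Sym2 V) ≠ f ∧ (∀ x ∈ (e : Sym2 V), x ∈ T.1) ∧ ∀ x ∈ (f : Sym2 V), x ∈ T.1 := by
  obtain ⟨⟨u, v, w⟩, huv, huw, hvw, hT⟩ := T.exists_eq
  rw [quadric_eq K G hT, triangleQuadric, coeff_add, coeff_add] at h
  have h1 : coeff (Finsupp.single e 1 + Finsupp.single f 1)
        (edgeVar K G u v * edgeVar K G v w) ≠ 0 ∨
      coeff (Finsupp.single e 1 + Finsupp.single f 1)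
        (edgeVar K G v w * edgeVar K G w u) ≠ 0 ∨
      coeff (Finsupp.single e 1 + Finsupp.single f 1)
        (edgeVar K G w u * edgeVar K G u v) ≠ 0 := by
    by_contra! h2
    exact h (by simp [h2])
  have huv := huv.ne
  have huw := huw.ne
  have hvw := hvw.ne
  rw [hT]
  rcases h1 with h1 | h1 | h1 <;> rcases of_coeff_edgeVar_mul_ne_zero h1 with ⟨he, hf⟩ | ⟨he, hf⟩ <;>
    rw [he, hf] <;> simp [huv, huw, hvw, huv.symm, huw.symm, hvw.symm]

theorem coeff_quadric_path {u v w : V} (huv : G.Adj u v) (hvw : G.Adj v w) (huw : u ≠ w)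
    (T : Triangle G) :
    coeff (Finsupp.single (⟨s(u, v), huv⟩ : G.edgeSet) 1 + Finsupp.single ⟨s(v, w), hvw⟩ 1)
      (quadric K G T) = if T.1 = {u, v, w} then sign K u v * sign K v w else 0 := by
  have huv' := huv.ne
  have hvw' := hvw.ne
  split_ifs with hT
  · rw [quadric_eq K G hT, triangleQuadric, coeff_add, coeff_add, coeff_edgeVar_mul_edgeVar]
    have h1 : coeff (Finsupp.single (⟨s(u, v), huv⟩ : G.edgeSet) 1 +
        Finsupp.single ⟨s(v, w), hvw⟩ 1) (edgeVar K G v w * edgeVar K G w u) = 0 := by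
      by_contra h
      have := of_coeff_edgeVar_mul_ne_zero h
      simp only [Sym2.eq_iff] at this
      grind
    have h2 : coeff (Finsupp.single (⟨s(u, v), huv⟩ : G.edgeSet) 1 +
        Finsupp.single ⟨s(v, w), hvw⟩ 1) (edgeVar K G w u * edgeVar K G u v) = 0 := by
      by_contra h
      have := of_coeff_edgeVar_mul_ne_zero h
      simp only [Sym2.eq_iff] at this
      grind
    rw [h1, h2, add_zero, add_zero]
  · by_contra h
    obtain ⟨-, h1, h2⟩ := of_coeff_quadric_ne_zero h
    simp only [Sym2.mem_iff, forall_eq_or_imp, forall_eq] at h1 h2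
    refine hT (Finset.eq_of_subset_of_card_le ?_ ?_).symm
    · simp only [Finset.insert_subset_iff, Finset.singleton_subset_iff]
      exact ⟨h1.1, h1.2, h2.2⟩
    · rw [T.2.card_eq, Finset.card_eq_three.2 ⟨u, v, w, huv', huw, hvw', rfl⟩]

theorem coeff_quadric_self (e : G.edgeSet) (T : Triangle G) :
    coeff (Finsupp.single e 1 + Finsupp.single e 1) (quadric K G T) = 0 := by
  by_contra h
  exact (of_coeff_quadric_ne_zero h).1 rfl

theorem coeff_quadric_of_disjoint {e f : G.edgeSet} {u v w x : V} (he : (e : Sym2 V) = s(u, v))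
    (hf : (f : Sym2 V) = s(w, x)) (huw : u ≠ w) (hux : u ≠ x) (hvw : v ≠ w) (hvx : v ≠ x)
    (T : Triangle G) :
    coeff (Finsupp.single e 1 + Finsupp.single f 1) (quadric K G T) = 0 := by
  by_contra h
  obtain ⟨-, h1, h2⟩ := of_coeff_quadric_ne_zero h
  have huv : u ≠ v := by
    have h3 := e.2
    rw [he, SimpleGraph.mem_edgeSet] at h3
    exact h3.ne
  have hwx : w ≠ x := by
    have h3 := f.2
    rw [hf, SimpleGraph.mem_edgeSet] at h3
    exact h3.ne
  rw [he] at h1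
  rw [hf] at h2
  simp only [Sym2.mem_iff, forall_eq_or_imp, forall_eq] at h1 h2
  have h3 : ({u, v, w, x} : Finset V) ⊆ T.1 := by
    simp only [Finset.insert_subset_iff, Finset.singleton_subset_iff]
    exact ⟨h1.1, h1.2, h2.1, h2.2⟩
  have h4 := Finset.card_le_card h3
  rw [T.2.card_eq] at h4
  simp [*] at h4

end Coefficients

theorem linearIndependent_quadric : LinearIndependent K (quadric K G) := by
  rw [linearIndependent_iff']
  intro s c hc T hT
  obtain ⟨⟨u, v, w⟩, huv, huw, hvw, hTe⟩ := T.exists_eq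
  have h1 := congrArg (coeff (Finsupp.single (⟨s(u, v), huv⟩ : G.edgeSet) 1 +
    Finsupp.single ⟨s(v, w), hvw⟩ 1)) hc
  simp only [coeff_sum, coeff_smul, coeff_quadric_path huv hvw huw.ne, coeff_zero] at h1
  rw [Finset.sum_eq_single T] at h1
  · rw [if_pos hTe, smul_eq_mul] at h1
    exact (mul_eq_zero.1 h1).resolve_right
      (mul_ne_zero (sign_ne_zero K u v) (sign_ne_zero K v w))
  · intro T' _ hT'
    rw [if_neg fun h => hT' (Subtype.ext (h.trans hTe.symm)), smul_zero]
  · exact fun h => (h hT).elim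

end GraphicOT

namespace GraphicOT

variable {K : Type*} [Field K] {V : Type*} {G : SimpleGraph V}

theorem eq_mk_of_mem {f : G.edgeSet} {x : V} (h : x ∈ (f : Sym2 V)) :
    ∃ (y : V) (hxy : G.Adj x y), f = ⟨s(x, y), hxy⟩ := by
  obtain ⟨f, hf⟩ := f
  obtain ⟨y, rfl⟩ := Sym2.mem_iff_exists.1 h
  exact ⟨y, hf, rfl⟩

theorem triangle_edges_ne {u v w : V} (huv : G.Adj u v) (hvw : G.Adj v w) (hwu : G.Adj w u) :
    (⟨s(u, v), huv⟩ : G.edgeSet) ≠ ⟨s(v, w), hvw⟩ ∧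
    (⟨s(u, v), huv⟩ : G.edgeSet) ≠ ⟨s(w, u), hwu⟩ ∧
    (⟨s(v, w), hvw⟩ : G.edgeSet) ≠ ⟨s(w, u), hwu⟩ := by
  have h1 := huv.ne
  have h2 := hvw.ne
  have h3 := hwu.ne
  refine ⟨fun h => ?_, fun h => ?_, fun h => ?_⟩ <;>
  · have h4 := congrArg Subtype.val h
    simp only [Sym2.eq_iff] at h4
    grind

variable [DecidableEq V]

theorem graphForm_eq_zero {e : G.edgeSet} {x : V} (h : x ∉ (e : Sym2 V)) :
    graphForm K G e x = 0 := by
  obtain ⟨e, he⟩ := e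
  induction e using Sym2.ind with
  | _ u v =>
    rw [graphForm_apply K G he]
    rw [Sym2.mem_iff, not_or] at h
    simp [h.1, h.2]

theorem graphForm_left {u v : V} (h : G.Adj u v) :
    graphForm K G ⟨s(u, v), h⟩ u = sign K u v := by
  rw [graphForm_apply K G h]
  simp [h.ne]

theorem graphForm_right {u v : V} (h : G.Adj u v) :
    graphForm K G ⟨s(u, v), h⟩ v = -sign K u v := by
  rw [graphForm_apply K G h]
  simp [h.ne']

theorem graphForm_ne_zero {e : G.edgeSet} {x : V} (h : x ∈ (e : Sym2 V)) :
    graphForm K G e x ≠ 0 := by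
  obtain ⟨e, he⟩ := e
  induction e using Sym2.ind with
  | _ u v =>
    rcases Sym2.mem_iff.1 h with rfl | rfl
    · rw [graphForm_left he]
      exact sign_ne_zero K _ _
    · rw [graphForm_right he]
      exact neg_ne_zero.2 (sign_ne_zero K _ _)

variable [Fintype V] [DecidableRel G.Adj]

theorem mem_graphRelSpace {c : G.edgeSet → K} :
    c ∈ graphRelSpace K G ↔ ∀ x, ∑ e, c e * graphForm K G e x = 0 := by
  rw [graphRelSpace, LinearMap.mem_ker]
  change ∑ e, c e • graphForm K G e = 0 ↔ _
  rw [funext_iff]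
  simp only [Finset.sum_apply, Pi.smul_apply, smul_eq_mul, Pi.zero_apply]

theorem exists_ne_mem_vsupp {c : G.edgeSet → K} (hc : c ∈ graphRelSpace K G) {e : G.edgeSet}
    (he : e ∈ vsupp c) {x : V} (hx : x ∈ (e : Sym2 V)) :
    ∃ f ∈ vsupp c, f ≠ e ∧ x ∈ (f : Sym2 V) := by
  by_contra! h
  have h1 := mem_graphRelSpace.1 hc x
  rw [Finset.sum_eq_single e] at h1
  · exact mul_ne_zero (mem_vsupp.1 he) (graphForm_ne_zero hx) h1
  · intro f _ hf
    by_cases h2 : c f = 0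
    · rw [h2, zero_mul]
    · rw [graphForm_eq_zero (h f (mem_vsupp.2 h2) hf), mul_zero]
  · simp

/-- The support of a nonzero relation contains an edge together with one further edge at each of
its ends. -/
theorem exists_edges_mem_vsupp {c : G.edgeSet → K} (hc : c ∈ graphRelSpace K G) (h0 : c ≠ 0) :
    ∃ (u v w w' : V) (huv : G.Adj u v) (huw : G.Adj u w) (hvw : G.Adj v w'), w ≠ v ∧ w' ≠ u ∧
      ({⟨s(u, v), huv⟩, ⟨s(u, w), huw⟩, ⟨s(v, w'), hvw⟩} : Finset G.edgeSet) ⊆ vsupp c ∧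
      ({⟨s(u, v), huv⟩, ⟨s(u, w), huw⟩, ⟨s(v, w'), hvw⟩} : Finset G.edgeSet).card = 3 := by
  obtain ⟨e, he⟩ := Function.ne_iff.1 h0
  obtain ⟨e, hadj⟩ := e
  induction e using Sym2.ind with
  | _ u v =>
    have he' : (⟨s(u, v), hadj⟩ : G.edgeSet) ∈ vsupp c := mem_vsupp.2 he
    obtain ⟨f, hf, hfe, hfu⟩ := exists_ne_mem_vsupp hc he' (Sym2.mem_mk_left u v)
    obtain ⟨g, hg, hge, hgv⟩ := exists_ne_mem_vsupp hc he' (Sym2.mem_mk_right u v)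
    obtain ⟨w, huw, rfl⟩ := eq_mk_of_mem hfu
    obtain ⟨w', hvw, rfl⟩ := eq_mk_of_mem hgv
    have h1 : w ≠ v := by
      rintro rfl
      exact hfe rfl
    have h2 : w' ≠ u := by
      rintro rfl
      exact hge (Subtype.ext Sym2.eq_swap)
    refine ⟨u, v, w, w', hadj, huw, hvw, h1, h2, ?_, ?_⟩
    · simp only [Finset.insert_subset_iff, Finset.singleton_subset_iff]
      exact ⟨he', hf, hg⟩
    · have h3 := hadj.ne
      refine Finset.card_eq_three.2 ⟨_, _, _, hfe.symm, hge.symm, ?_, rfl⟩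
      intro h
      have h4 := congrArg Subtype.val h
      simp only [Sym2.eq_iff] at h4
      grind

theorem three_le_card_vsupp {c : G.edgeSet → K} (hc : c ∈ graphRelSpace K G) (h0 : c ≠ 0) :
    3 ≤ (vsupp c).card := by
  obtain ⟨u, v, w, w', huv, huw, hvw, -, -, h1, h2⟩ := exists_edges_mem_vsupp hc h0
  rw [← h2]
  exact Finset.card_le_card h1

theorem exists_triangle_of_card_vsupp {c : G.edgeSet → K} (hc : c ∈ graphRelSpace K G)
    (h : (vsupp c).card = 3) :
    ∃ (u v w : V) (huv : G.Adj u v) (hvw : G.Adj v w) (hwu : G.Adj w u),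
      vsupp c = {⟨s(u, v), huv⟩, ⟨s(v, w), hvw⟩, ⟨s(w, u), hwu⟩} := by
  have h0 : c ≠ 0 := by
    rintro rfl
    simp [vsupp] at h
  obtain ⟨u, v, w, w', huv, huw, hvw, h1, h2, hsub, hcard⟩ := exists_edges_mem_vsupp hc h0
  have heq := Finset.eq_of_subset_of_card_le hsub (by omega)
  obtain ⟨f, hf, hfe, hfw⟩ := exists_ne_mem_vsupp hc (e := ⟨s(u, w), huw⟩)
    (by rw [← heq]; simp) (Sym2.mem_mk_right u w)
  rw [← heq] at hf
  have h3 := huw.ne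
  obtain rfl : w = w' := by
    simp only [Finset.mem_insert, Finset.mem_singleton] at hf
    rcases hf with rfl | rfl | rfl
    · simp only [Sym2.mem_iff] at hfw
      grind
    · exact (hfe rfl).elim
    · simp only [Sym2.mem_iff] at hfw
      grind
  refine ⟨u, v, w, huv, hvw, huw.symm, ?_⟩
  rw [← heq]
  have h9 : (⟨s(w, u), huw.symm⟩ : G.edgeSet) = ⟨s(u, w), huw⟩ := Subtype.ext Sym2.eq_swap
  rw [h9, Finset.pair_comm]

section Triangle

variable {u v w : V} (huv : G.Adj u v) (hvw : G.Adj v w) (hwu : G.Adj w u)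

theorem otgen_triangle {c : G.edgeSet → K} {t : K}
    (hc : vsupp c = {⟨s(u, v), huv⟩, ⟨s(v, w), hvw⟩, ⟨s(w, u), hwu⟩})
    (h1 : c ⟨s(u, v), huv⟩ = t * sign K u v) (h2 : c ⟨s(v, w), hvw⟩ = t * sign K v w)
    (h3 : c ⟨s(w, u), hwu⟩ = t * sign K w u) :
    otgen c = (t * (sign K u v * sign K v w * sign K w u)) • triangleQuadric K G u v w := by
  obtain ⟨h4, h5, h6⟩ := triangle_edges_ne huv hvw hwu
  rw [otgen_eq_of_vsupp_eq h4 h5 h6 hc, X_eq_edgeVar K G huv, X_eq_edgeVar K G hvw,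
    X_eq_edgeVar K G hwu, h1, h2, h3, triangleQuadric, smul_eq_C_mul]
  simp only [C_mul]
  ring

theorem sum_mul_graphForm {c : G.edgeSet → K}
    (hc : vsupp c = {⟨s(u, v), huv⟩, ⟨s(v, w), hvw⟩, ⟨s(w, u), hwu⟩}) (x : V) :
    ∑ e, c e * graphForm K G e x = c ⟨s(u, v), huv⟩ * graphForm K G ⟨s(u, v), huv⟩ x +
      (c ⟨s(v, w), hvw⟩ * graphForm K G ⟨s(v, w), hvw⟩ x +
        c ⟨s(w, u), hwu⟩ * graphForm K G ⟨s(w, u), hwu⟩ x) := by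
  obtain ⟨h4, h5, h6⟩ := triangle_edges_ne huv hvw hwu
  rw [← Finset.sum_subset (Finset.subset_univ (vsupp c)), hc,
    Finset.sum_insert (by simp only [Finset.mem_insert, Finset.mem_singleton]; tauto),
    Finset.sum_insert (by simpa only [Finset.mem_singleton] using h6), Finset.sum_singleton]
  intro e _ he
  rw [mem_vsupp, not_not] at he
  rw [he, zero_mul]

theorem otgen_eq_smul_triangleQuadric {c : G.edgeSet → K} (hrel : c ∈ graphRelSpace K G)
    (hc : vsupp c = {⟨s(u, v), huv⟩, ⟨s(v, w), hvw⟩, ⟨s(w, u), hwu⟩}) :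
    ∃ t : K, otgen c = t • triangleQuadric K G u v w := by
  have hu := mem_graphRelSpace.1 hrel u
  have hv := mem_graphRelSpace.1 hrel v
  have h1 := huv.ne
  have h2 := hvw.ne
  have h3 := hwu.ne
  rw [sum_mul_graphForm huv hvw hwu hc, graphForm_left, graphForm_right,
    graphForm_eq_zero (by simp only [Sym2.mem_iff]; grind)] at hu
  rw [sum_mul_graphForm huv hvw hwu hc, graphForm_left, graphForm_right,
    graphForm_eq_zero (by simp only [Sym2.mem_iff]; grind)] at hv
  have h4 := sign_mul_self K u v
  have h5 := sign_mul_self K v w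
  have h6 := sign_mul_self K w u
  refine ⟨_, otgen_triangle huv hvw hwu (t := c ⟨s(u, v), huv⟩ * sign K u v) hc ?_ ?_ ?_⟩
  · linear_combination (-c ⟨s(u, v), huv⟩) * h4
  · linear_combination (-c ⟨s(v, w), hvw⟩) * h5 + sign K v w * hv
  · linear_combination (-c ⟨s(w, u), hwu⟩) * h6 - sign K w u * hu

end Triangle

theorem triangleQuadric_mem {u v w : V} (huv : G.Adj u v) (hvw : G.Adj v w) (hwu : G.Adj w u) :
    triangleQuadric K G u v w ∈ graphOTIdeal K G := by
  obtain ⟨h1, h2, h3⟩ := triangle_edges_ne huv hvw hwu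
  let c : G.edgeSet → K := fun e =>
    if e = ⟨s(u, v), huv⟩ then sign K u v else
      if e = ⟨s(v, w), hvw⟩ then sign K v w else if e = ⟨s(w, u), hwu⟩ then sign K w u else 0
  have c1 : c ⟨s(u, v), huv⟩ = sign K u v := if_pos rfl
  have c2 : c ⟨s(v, w), hvw⟩ = sign K v w := (if_neg h1.symm).trans (if_pos rfl)
  have c3 : c ⟨s(w, u), hwu⟩ = sign K w u :=
    (if_neg h2.symm).trans ((if_neg h3.symm).trans (if_pos rfl))
  have hc : vsupp c = {⟨s(u, v), huv⟩, ⟨s(v, w), hvw⟩, ⟨s(w, u), hwu⟩} := by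
    ext e
    simp only [mem_vsupp, Finset.mem_insert, Finset.mem_singleton]
    constructor
    · intro h
      by_contra! h4
      simp only [c] at h
      rw [if_neg h4.1, if_neg h4.2.1, if_neg h4.2.2] at h
      exact h rfl
    · rintro (rfl | rfl | rfl)
      · rw [c1]; exact sign_ne_zero K _ _
      · rw [c2]; exact sign_ne_zero K _ _
      · rw [c3]; exact sign_ne_zero K _ _
  have hrel : c ∈ graphRelSpace K G := by
    rw [mem_graphRelSpace]
    intro x
    rw [sum_mul_graphForm huv hvw hwu hc, c1, c2, c3, graphForm_apply K G huv,
      graphForm_apply K G hvw, graphForm_apply K G hwu]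
    simp only [Pi.smul_apply, Pi.sub_apply, smul_eq_mul, ← mul_assoc, sign_mul_self, one_mul]
    ring
  have h4 := otgen_triangle huv hvw hwu (t := 1) hc (by rw [c1, one_mul]) (by rw [c2, one_mul])
    (by rw [c3, one_mul])
  set t := sign K u v * sign K v w * sign K w u
  have ht : t * t = 1 := by
    have h4 := sign_mul_self K u v
    have h5 := sign_mul_self K v w
    have h6 := sign_mul_self K w u
    simp only [t]
    linear_combination (sign K v w * sign K v w * sign K w u * sign K w u) * h4 +
      sign K w u * sign K w u * h5 + h6
  have h5 : triangleQuadric K G u v w = C t * otgen c := by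
    rw [h4, one_mul, ← smul_eq_C_mul, smul_smul, ht, one_smul]
  rw [h5]
  exact Ideal.mul_mem_left _ _ (Ideal.subset_span ⟨c, hrel, rfl⟩)

theorem quadric_mem (T : Triangle G) : quadric K G T ∈ graphOTIdeal K G := by
  obtain ⟨⟨u, v, w⟩, huv, huw, hvw, hT⟩ := T.exists_eq
  rw [quadric_eq K G hT]
  exact triangleQuadric_mem huv hvw huw.symm

theorem exists_isHomogeneous_otgen {c : G.edgeSet → K} (hc : c ∈ graphRelSpace K G) :
    ∃ d, 2 ≤ d ∧ (otgen c).IsHomogeneous d := by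
  by_cases h0 : c = 0
  · refine ⟨2, le_rfl, ?_⟩
    have h : otgen c = 0 := by simp [otgen, vsupp, h0]
    rw [h]
    exact isHomogeneous_zero _ _ _
  · exact ⟨_, by have := three_le_card_vsupp hc h0; omega, otgen_isHomogeneous c⟩

theorem otgen_mem_span_quadric {c : G.edgeSet → K} (hc : c ∈ graphRelSpace K G)
    (h2 : (otgen c).IsHomogeneous 2) :
    otgen c ∈ Submodule.span K (Set.range (quadric K G)) := by
  by_cases h0 : otgen c = 0
  · rw [h0]
    exact Submodule.zero_mem _
  · have h1 := (otgen_isHomogeneous c).inj_right h2 h0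
    obtain ⟨u, v, w, huv, hvw, hwu, h⟩ := exists_triangle_of_card_vsupp hc (by omega)
    obtain ⟨t, ht⟩ := otgen_eq_smul_triangleQuadric huv hvw hwu hc h
    rw [ht]
    have hT : G.IsNClique 3 {u, v, w} :=
      SimpleGraph.is3Clique_triple_iff.2 ⟨huv, hwu.symm, hvw⟩
    exact Submodule.smul_mem _ _
      (Submodule.subset_span ⟨⟨_, hT⟩, quadric_eq K G (T := ⟨_, hT⟩) rfl⟩)

end GraphicOT

namespace GraphicOT

variable {K : Type*} [Field K] {V : Type*} {G : SimpleGraph V}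

theorem mk_ne_mk {u v w x : V} (huv : G.Adj u v) (hwx : G.Adj w x)
    (h : ¬ (u = w ∧ v = x ∨ u = x ∧ v = w)) :
    (⟨s(u, v), huv⟩ : G.edgeSet) ≠ ⟨s(w, x), hwx⟩ := fun h1 =>
  h (Sym2.eq_iff.1 (congrArg Subtype.val h1))

variable [DecidableEq V]

section SignedCoeff

variable [DecidableRel G.Adj]

/-- The coordinate of the edge `uv` and the triangle `T`, with the sign making it antisymmetric in
`u` and `v`; it is zero if `uv` is not an edge or `T` is not a triangle. -/
noncomputable def signedCoeff (T : Finset V) (u v : V) :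
    (G.edgeSet → Triangle G → K) →ₗ[K] K :=
  if h : G.IsNClique 3 T ∧ G.Adj u v then
    sign K u v • ((LinearMap.proj ⟨T, h.1⟩ : (Triangle G → K) →ₗ[K] K).comp
      (LinearMap.proj ⟨s(u, v), h.2⟩ : (G.edgeSet → Triangle G → K) →ₗ[K] Triangle G → K))
  else 0

theorem signedCoeff_apply (a : G.edgeSet → Triangle G → K) (T : Triangle G) {u v : V}
    (h : G.Adj u v) : signedCoeff T.1 u v a = sign K u v * a ⟨s(u, v), h⟩ T := by
  rw [signedCoeff, dif_pos ⟨T.2, h⟩]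
  rfl

theorem apply_eq_signedCoeff (a : G.edgeSet → Triangle G → K) (T : Triangle G) {u v : V}
    (h : G.Adj u v) : a ⟨s(u, v), h⟩ T = sign K u v * signedCoeff T.1 u v a := by
  rw [signedCoeff_apply a T h, ← mul_assoc, sign_mul_self, one_mul]

theorem of_signedCoeff_ne_zero {a : G.edgeSet → Triangle G → K} {T : Finset V} {u v : V}
    (h : signedCoeff T u v a ≠ 0) : G.IsNClique 3 T ∧ G.Adj u v := by
  by_contra h1
  rw [signedCoeff, dif_neg h1] at h
  exact h rfl

theorem signedCoeff_swap (a : G.edgeSet → Triangle G → K) (T : Finset V) (u v : V) :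
    signedCoeff T v u a = -signedCoeff T u v a := by
  by_cases h : G.IsNClique 3 T ∧ G.Adj u v
  · have h1 : (⟨s(v, u), h.2.symm⟩ : G.edgeSet) = ⟨s(u, v), h.2⟩ := Subtype.ext Sym2.eq_swap
    rw [signedCoeff_apply a ⟨T, h.1⟩ h.2, signedCoeff_apply a ⟨T, h.1⟩ h.2.symm, h1,
      sign_swap K h.2.ne, neg_mul]
  · rw [signedCoeff, signedCoeff, dif_neg h, dif_neg fun h1 => h ⟨h1.1, h1.2.symm⟩]
    simp

end SignedCoeff

variable [DecidableRel G.Adj] [Fintype (Triangle G)]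

/-- The coefficient of `y_e y_f` in the quadric with which `y_g` is multiplied. -/
noncomputable def crossCoeff (a : G.edgeSet → Triangle G → K) (e f g : G.edgeSet) : K :=
  coeff (Finsupp.single e 1 + Finsupp.single f 1) (∑ T, a g T • quadric K G T)

variable {a : G.edgeSet → Triangle G → K}

theorem crossCoeff_eq (e f g : G.edgeSet) : crossCoeff a e f g =
    ∑ T, a g T * coeff (Finsupp.single e 1 + Finsupp.single f 1) (quadric K G T) := by
  simp [crossCoeff, coeff_sum, coeff_smul]

theorem crossCoeff_self (e g : G.edgeSet) : crossCoeff a e e g = 0 := by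
  simp [crossCoeff_eq, coeff_quadric_self]

theorem crossCoeff_of_disjoint {u v w x : V} (huv : G.Adj u v) (hwx : G.Adj w x) (huw : u ≠ w)
    (hux : u ≠ x) (hvw : v ≠ w) (hvx : v ≠ x) (g : G.edgeSet) :
    crossCoeff a ⟨s(u, v), huv⟩ ⟨s(w, x), hwx⟩ g = 0 := by
  rw [crossCoeff_eq]
  refine Finset.sum_eq_zero fun T _ => ?_
  rw [coeff_quadric_of_disjoint rfl rfl huw hux hvw hvx T, mul_zero]

theorem crossCoeff_path {u v w x y : V} (huv : G.Adj u v) (hvw : G.Adj v w) (huw : u ≠ w)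
    (hxy : G.Adj x y) :
    crossCoeff a ⟨s(u, v), huv⟩ ⟨s(v, w), hvw⟩ ⟨s(x, y), hxy⟩ =
      sign K u v * sign K v w * sign K x y * signedCoeff {u, v, w} x y a := by
  simp only [crossCoeff_eq, coeff_quadric_path huv hvw huw]
  by_cases hT : G.IsNClique 3 {u, v, w}
  · rw [Finset.sum_eq_single ⟨_, hT⟩, if_pos rfl, apply_eq_signedCoeff a ⟨_, hT⟩ hxy]
    · ring
    · intro T _ h
      rw [if_neg fun h1 => h (Subtype.ext h1), mul_zero]
    · simp
  · rw [signedCoeff, dif_neg fun h => hT h.1]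
    rw [LinearMap.zero_apply, mul_zero]
    refine Finset.sum_eq_zero fun T _ => ?_
    have h : T.1 ≠ {u, v, w} := fun h => hT (h ▸ T.2)
    rw [if_neg h, mul_zero]

variable [Fintype V]

theorem coeff_linSyz_eq_zero (ha : a ∈ LinearMap.ker (linSyzMap K G.edgeSet (quadric K G)))
    (m : G.edgeSet →₀ ℕ) :
    ∑ g ∈ m.support, coeff (m - Finsupp.single g 1) (∑ T, a g T • quadric K G T) = 0 := by
  rw [← coeff_sum_X_mul]
  rw [LinearMap.mem_ker, linSyzMap_apply] at ha
  simp only [smul_eq_mul] at ha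
  rw [ha, coeff_zero]

theorem crossCoeff_left (ha : a ∈ LinearMap.ker (linSyzMap K G.edgeSet (quadric K G)))
    {e f : G.edgeSet} (hef : e ≠ f) : crossCoeff a e f e = 0 := by
  have h := coeff_linSyz_eq_zero ha (Finsupp.single e 1 + Finsupp.single e 1 + Finsupp.single f 1)
  have hs : (Finsupp.single e 1 + Finsupp.single e 1 + Finsupp.single f 1 :
      G.edgeSet →₀ ℕ).support = {e, f} := by
    ext g
    simp only [Finsupp.mem_support_iff, Finsupp.add_apply, Finsupp.single_apply, Finset.mem_insert,
      Finset.mem_singleton]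
    grind
  rw [hs, Finset.sum_pair hef, add_tsub_cancel_right] at h
  rw [show (Finsupp.single e 1 + Finsupp.single e 1 + Finsupp.single f 1 - Finsupp.single e 1 :
      G.edgeSet →₀ ℕ) = Finsupp.single e 1 + Finsupp.single f 1 by
    rw [add_assoc, add_tsub_cancel_left]] at h
  have h1 := crossCoeff_self (a := a) e f
  rw [crossCoeff] at h1 ⊢
  rwa [h1, add_zero] at h

theorem crossCoeff_cyclic (ha : a ∈ LinearMap.ker (linSyzMap K G.edgeSet (quadric K G)))
    {e f g : G.edgeSet} (hef : e ≠ f) (heg : e ≠ g) (hfg : f ≠ g) :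
    crossCoeff a e f g + crossCoeff a f g e + crossCoeff a g e f = 0 := by
  have h := coeff_linSyz_eq_zero ha (Finsupp.single e 1 + Finsupp.single f 1 + Finsupp.single g 1)
  have hs : (Finsupp.single e 1 + Finsupp.single f 1 + Finsupp.single g 1 :
      G.edgeSet →₀ ℕ).support = {g, e, f} := by
    ext i
    simp only [Finsupp.mem_support_iff, Finsupp.add_apply, Finsupp.single_apply, Finset.mem_insert,
      Finset.mem_singleton]
    grind
  rw [hs, Finset.sum_insert (by simp [heg.symm, hfg.symm]), Finset.sum_pair hef,
    add_tsub_cancel_right] at h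
  rw [show (Finsupp.single e 1 + Finsupp.single f 1 + Finsupp.single g 1 - Finsupp.single e 1 :
      G.edgeSet →₀ ℕ) = Finsupp.single f 1 + Finsupp.single g 1 by
    rw [add_assoc, add_tsub_cancel_left]] at h
  rw [show (Finsupp.single e 1 + Finsupp.single f 1 + Finsupp.single g 1 - Finsupp.single f 1 :
      G.edgeSet →₀ ℕ) = Finsupp.single g 1 + Finsupp.single e 1 by
    rw [add_right_comm, add_tsub_cancel_right, add_comm]] at h
  rw [add_assoc]
  exact h

theorem signedCoeff_of_mem_of_mem
    (ha : a ∈ LinearMap.ker (linSyzMap K G.edgeSet (quadric K G))) {T : Finset V} {u v : V}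
    (hu : u ∈ T) (hv : v ∈ T) : signedCoeff T u v a = 0 := by
  by_contra h
  obtain ⟨hT, huv⟩ := of_signedCoeff_ne_zero h
  obtain ⟨w, hw, hwuv⟩ := Finset.exists_mem_notMem_of_card_lt_card
    (s := {u, v}) (t := T) (by rw [hT.card_eq, Finset.card_pair huv.ne]; norm_num)
  simp only [Finset.mem_insert, Finset.mem_singleton, not_or] at hwuv
  have hvw : G.Adj v w := hT.isClique hv hw (Ne.symm hwuv.2)
  have h1 := huv.ne
  obtain rfl : {u, v, w} = T := by
    refine Finset.eq_of_subset_of_card_le ?_ ?_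
    · simp [Finset.insert_subset_iff, *]
    · rw [hT.card_eq, Finset.card_eq_three.2 ⟨u, v, w, h1, Ne.symm hwuv.1, hvw.ne, rfl⟩]
  have h2 := crossCoeff_left ha (e := ⟨s(u, v), huv⟩) (f := ⟨s(v, w), hvw⟩) (mk_ne_mk _ _ (by grind))
  rw [crossCoeff_path huv hvw (Ne.symm hwuv.1)] at h2
  simp [sign_ne_zero, h] at h2

theorem signedCoeff_of_notMem_of_notMem
    (ha : a ∈ LinearMap.ker (linSyzMap K G.edgeSet (quadric K G))) {T : Finset V} {u v : V}
    (hu : u ∉ T) (hv : v ∉ T) : signedCoeff T u v a = 0 := by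
  by_contra h
  obtain ⟨hT, huv⟩ := of_signedCoeff_ne_zero h
  obtain ⟨x, y, z, hxy, hxz, hyz, rfl⟩ := SimpleGraph.is3Clique_iff.1 hT
  simp only [Finset.mem_insert, Finset.mem_singleton, not_or] at hu hv
  have h1 := crossCoeff_cyclic ha (e := ⟨s(x, y), hxy⟩) (f := ⟨s(y, z), hyz⟩)
    (g := ⟨s(u, v), huv⟩) (triangle_edges_ne hxy hyz hxz.symm).1
    (mk_ne_mk _ _ (by grind))
    (mk_ne_mk _ _ (by grind))
  rw [crossCoeff_path hxy hyz hxz.ne, crossCoeff_of_disjoint hyz huv (by grind) (by grind)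
    (by grind) (by grind), crossCoeff_of_disjoint huv hxy (by grind) (by grind)
    (by grind) (by grind)] at h1
  simp [sign_ne_zero, h] at h1

theorem signedCoeff_path (ha : a ∈ LinearMap.ker (linSyzMap K G.edgeSet (quadric K G)))
    {w v x y : V} (hwx : w ≠ x) (hwy : w ≠ y) (hvx : v ≠ x) (hvy : v ≠ y) (hxy : x ≠ y) :
    signedCoeff {v, x, y} w v a + signedCoeff {w, v, x} x y a = 0 := by
  by_cases h : G.Adj w v ∧ G.Adj v x ∧ G.Adj x y
  · obtain ⟨h1, h2, h3⟩ := h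
    have h4 := crossCoeff_cyclic ha (e := ⟨s(w, v), h1⟩) (f := ⟨s(v, x), h2⟩)
      (g := ⟨s(x, y), h3⟩)
      (mk_ne_mk _ _ (by grind))
      (mk_ne_mk _ _ (by grind))
      (mk_ne_mk _ _ (by grind))
    rw [crossCoeff_path h1 h2 hwx, crossCoeff_path h2 h3 hvy,
      crossCoeff_of_disjoint h3 h1 hwx.symm hvx.symm hwy.symm hvy.symm] at h4
    refine (mul_eq_zero.1 (?_ : sign K w v * sign K v x * sign K x y * _ = 0)).resolve_left
      (by simp [sign_ne_zero])
    linear_combination h4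
  · have h1 : signedCoeff {v, x, y} w v a = 0 := by
      by_contra h1
      obtain ⟨h2, h3⟩ := of_signedCoeff_ne_zero h1
      have h4 := SimpleGraph.is3Clique_triple_iff.1 h2
      exact h ⟨h3, h4.1, h4.2.2⟩
    have h2 : signedCoeff {w, v, x} x y a = 0 := by
      by_contra h1
      obtain ⟨h2, h3⟩ := of_signedCoeff_ne_zero h1
      have h4 := SimpleGraph.is3Clique_triple_iff.1 h2
      exact h ⟨h4.1, h4.2.2, h3⟩
    rw [h1, h2, add_zero]

theorem signedCoeff_star (ha : a ∈ LinearMap.ker (linSyzMap K G.edgeSet (quadric K G)))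
    {w v x y : V} (hwv : w ≠ v) (hwx : w ≠ x) (hwy : w ≠ y) (hvx : v ≠ x) (hxy : x ≠ y) :
    signedCoeff {v, x, y} v w a + signedCoeff {y, v, w} v x a + signedCoeff {w, v, x} v y a
      = 0 := by
  by_cases h : G.Adj v w ∧ G.Adj v x ∧ G.Adj v y
  · obtain ⟨h1, h2, h3⟩ := h
    have h4 := crossCoeff_cyclic ha (e := ⟨s(v, w), h1⟩) (f := ⟨s(v, x), h2⟩)
      (g := ⟨s(v, y), h3⟩)
      (mk_ne_mk _ _ (by grind))
      (mk_ne_mk _ _ (by grind))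
      (mk_ne_mk _ _ (by grind))
    have star : ∀ {p q r : V} (hp : G.Adj v p) (hq : G.Adj v q) (hr : G.Adj v r), p ≠ q →
        crossCoeff a ⟨s(v, p), hp⟩ ⟨s(v, q), hq⟩ ⟨s(v, r), hr⟩ =
          -(sign K v p * sign K v q * sign K v r * signedCoeff {p, v, q} v r a) := by
      intro p q r hp hq hr hpq
      have h5 : (⟨s(v, p), hp⟩ : G.edgeSet) = ⟨s(p, v), hp.symm⟩ := Subtype.ext Sym2.eq_swap
      rw [h5, crossCoeff_path hp.symm hq hpq, sign_swap K hp.ne]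
      ring
    rw [star h1 h2 h3 hwx, star h2 h3 h1 hxy, star h3 h1 h2 hwy.symm] at h4
    rw [Finset.insert_comm v x]
    refine (mul_eq_zero.1 (?_ : sign K v w * sign K v x * sign K v y * _ = 0)).resolve_left
      (by simp [sign_ne_zero])
    linear_combination -h4
  · have star : ∀ {p q r : V}, ¬ (G.Adj v p ∧ G.Adj v q ∧ G.Adj v r) →
        signedCoeff {p, v, q} v r a = 0 := by
      intro p q r h1
      by_contra h2
      obtain ⟨h3, h4⟩ := of_signedCoeff_ne_zero h2
      have h5 := SimpleGraph.is3Clique_triple_iff.1 h3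
      exact h1 ⟨h5.1.symm, h5.2.2, h4⟩
    rw [Finset.insert_comm v x, star (by tauto), star (by tauto), star (by tauto)]
    ring

end GraphicOT

namespace GraphicOT

variable {K : Type*} [Field K] {V : Type*} {G : SimpleGraph V} [DecidableEq V]

/-- `w`, `v`, `x`, `y` enumerate the four elements of `Q` without repetition. -/
structure IsEnum (Q : Finset V) (w v x y : V) : Prop where
  eq_insert : Q = {w, v, x, y}
  ne₁₂ : w ≠ v
  ne₁₃ : w ≠ x
  ne₁₄ : w ≠ y
  ne₂₃ : v ≠ x
  ne₂₄ : v ≠ y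
  ne₃₄ : x ≠ y

namespace IsEnum

variable {Q : Finset V} {w v x y : V}

theorem mem_iff (h : IsEnum Q w v x y) {p : V} : p ∈ Q ↔ p = w ∨ p = v ∨ p = x ∨ p = y := by
  simp [h.eq_insert]

theorem rotate (h : IsEnum Q w v x y) : IsEnum Q v x y w where
  eq_insert := by ext p; simp only [h.mem_iff, Finset.mem_insert, Finset.mem_singleton]; tauto
  ne₁₂ := h.ne₂₃
  ne₁₃ := h.ne₂₄
  ne₁₄ := h.ne₁₂.symm
  ne₂₃ := h.ne₃₄
  ne₂₄ := h.ne₁₃.symm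
  ne₃₄ := h.ne₁₄.symm

theorem swap (h : IsEnum Q w v x y) : IsEnum Q v w x y where
  eq_insert := by ext p; simp only [h.mem_iff, Finset.mem_insert, Finset.mem_singleton]; tauto
  ne₁₂ := h.ne₁₂.symm
  ne₁₃ := h.ne₂₃
  ne₁₄ := h.ne₂₄
  ne₂₃ := h.ne₁₃
  ne₂₄ := h.ne₁₄
  ne₃₄ := h.ne₃₄

theorem rotate_tail (h : IsEnum Q w v x y) : IsEnum Q w x y v := h.swap.rotate

theorem swap_tail (h : IsEnum Q w v x y) : IsEnum Q w v y x := h.rotate.rotate.swap.rotate.rotate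

theorem erase_eq (h : IsEnum Q w v x y) : Q.erase w = {v, x, y} := by
  obtain ⟨h0, h1, h2, h3, h4, h5, h6⟩ := h
  grind

end IsEnum

theorem exists_isEnum {Q : Finset V} (hQ : G.IsNClique 4 Q) :
    ∃ p : V × V × V × V, IsEnum Q p.1 p.2.1 p.2.2.1 p.2.2.2 := by
  obtain ⟨w, t, hw, rfl, ht⟩ := Finset.card_eq_succ.1 hQ.card_eq
  obtain ⟨v, x, y, hvx, hvy, hxy, rfl⟩ := Finset.card_eq_three.1 ht
  simp only [Finset.mem_insert, Finset.mem_singleton, not_or] at hw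
  exact ⟨(w, v, x, y), rfl, hw.1, hw.2.1, hw.2.2, hvx, hvy, hxy⟩

variable [Fintype V] [DecidableRel G.Adj] [Fintype (Triangle G)]
  {a : G.edgeSet → Triangle G → K}

theorem signedCoeff_erase_eq (ha : a ∈ LinearMap.ker (linSyzMap K G.edgeSet (quadric K G)))
    {Q : Finset V} {w v x y : V} (h : IsEnum Q w v x y) :
    signedCoeff (Q.erase w) w v a = signedCoeff (Q.erase x) x y a := by
  have h1 := signedCoeff_path ha h.ne₁₄ h.ne₁₃ h.ne₂₄ h.ne₂₃ h.ne₃₄.symm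
  rw [h.swap_tail.erase_eq, h.swap_tail.rotate.rotate.rotate.erase_eq, signedCoeff_swap a _ y x]
  linear_combination h1

theorem signedCoeff_erase_swap (ha : a ∈ LinearMap.ker (linSyzMap K G.edgeSet (quadric K G)))
    {Q : Finset V} {w v x y : V} (h : IsEnum Q w v x y) :
    signedCoeff (Q.erase w) w v a = signedCoeff (Q.erase v) v w a :=
  (signedCoeff_erase_eq ha h).trans (signedCoeff_erase_eq ha h.rotate.rotate.swap_tail)

theorem signedCoeff_erase_add (ha : a ∈ LinearMap.ker (linSyzMap K G.edgeSet (quadric K G)))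
    {Q : Finset V} {w v x y : V} (h : IsEnum Q w v x y) :
    signedCoeff (Q.erase w) w v a + signedCoeff (Q.erase w) w x a +
      signedCoeff (Q.erase w) w y a = 0 := by
  have h5 := signedCoeff_star ha h.ne₁₂.symm h.ne₂₃ h.ne₂₄ h.ne₁₃ h.ne₃₄
  have hv : Q.erase v = {w, x, y} := h.swap.erase_eq
  have hx : Q.erase x = {y, w, v} := h.rotate.rotate.erase_eq
  have hy : Q.erase y = {v, w, x} := h.swap.rotate.rotate.rotate.erase_eq
  rw [signedCoeff_erase_swap ha h, signedCoeff_erase_swap ha h.rotate_tail,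
    signedCoeff_erase_swap ha h.rotate_tail.rotate_tail, signedCoeff_swap a _ w v,
    signedCoeff_swap a _ w x, signedCoeff_swap a _ w y, hv, hx, hy]
  linear_combination -h5

theorem signedCoeff_erase_eq_zero
    (ha : a ∈ LinearMap.ker (linSyzMap K G.edgeSet (quadric K G)))
    {Q : Finset V} {w v x y : V} (h : IsEnum Q w v x y)
    (hv : signedCoeff (Q.erase w) w v a = 0) (hx : signedCoeff (Q.erase w) w x a = 0) {p q : V}
    (hp : p ∈ Q) (hq : q ∈ Q) (hpq : p ≠ q) : signedCoeff (Q.erase p) p q a = 0 := by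
  have hy := signedCoeff_erase_add ha h
  rw [hv, hx, zero_add, zero_add] at hy
  have key : ∀ {v x y : V}, IsEnum Q w v x y → signedCoeff (Q.erase w) w v a = 0 →
      signedCoeff (Q.erase v) v w a = 0 ∧ signedCoeff (Q.erase x) x y a = 0 ∧
        signedCoeff (Q.erase y) y x a = 0 := fun h h0 => by
    have h1 := signedCoeff_erase_swap ha h
    have h2 := signedCoeff_erase_eq ha h
    have h3 := signedCoeff_erase_swap ha h.rotate.rotate
    exact ⟨h1.symm.trans h0, h2.symm.trans h0, h3.symm.trans (h2.symm.trans h0)⟩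
  have kv := key h hv
  have kx := key h.rotate_tail hx
  have ky := key h.rotate_tail.rotate_tail hy
  rcases h.mem_iff.1 hp with rfl | rfl | rfl | rfl <;>
    rcases h.mem_iff.1 hq with rfl | rfl | rfl | rfl <;> first | exact (hpq rfl).elim | tauto

theorem isNClique_insert_of_signedCoeff_ne_zero
    (ha : a ∈ LinearMap.ker (linSyzMap K G.edgeSet (quadric K G))) {T : Finset V} {u v : V}
    (h : signedCoeff T u v a ≠ 0) (hu : u ∉ T) (hv : v ∈ T) : G.IsNClique 4 (insert u T) := by
  obtain ⟨hT, huv⟩ := of_signedCoeff_ne_zero h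
  refine hT.insert fun x hx => ?_
  by_cases hxv : x = v
  · exact hxv ▸ huv
  obtain ⟨y, hy, hyvx⟩ := Finset.exists_mem_notMem_of_card_lt_card
    (s := {v, x}) (t := T) (by rw [hT.card_eq, Finset.card_pair (Ne.symm hxv)]; norm_num)
  simp only [Finset.mem_insert, Finset.mem_singleton, not_or] at hyvx
  obtain rfl : {v, x, y} = T := by
    refine Finset.eq_of_subset_of_card_le ?_ ?_
    · simp [Finset.insert_subset_iff, *]
    · rw [hT.card_eq, Finset.card_eq_three.2
        ⟨v, x, y, Ne.symm hxv, Ne.symm hyvx.1, Ne.symm hyvx.2, rfl⟩]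
  have h1 := signedCoeff_path ha (w := u) (v := v) (x := x) (y := y) (by grind) (by grind)
    (by grind) (by grind) (by grind)
  have h2 : signedCoeff {u, v, x} x y a ≠ 0 := fun h2 => h (by simpa [h2] using h1)
  exact (SimpleGraph.is3Clique_triple_iff.1 (of_signedCoeff_ne_zero h2).1).2.1

/-- Linear syzygies are determined by their coordinates at the faces of 4-cliques. -/
theorem eq_zero_of_signedCoeff_erase
    (ha : a ∈ LinearMap.ker (linSyzMap K G.edgeSet (quadric K G)))
    (h : ∀ Q, G.IsNClique 4 Q → ∀ p ∈ Q, ∀ q ∈ Q, p ≠ q → signedCoeff (Q.erase p) p q a = 0) :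
    a = 0 := by
  have key : ∀ (T : Finset V) (u v : V), u ∉ T → v ∈ T → signedCoeff T u v a = 0 := by
    intro T u v hu hv
    by_contra h1
    have h2 := h _ (isNClique_insert_of_signedCoeff_ne_zero ha h1 hu hv) u
      (Finset.mem_insert_self _ _) v (Finset.mem_insert_of_mem hv)
      (of_signedCoeff_ne_zero h1).2.ne
    rw [Finset.erase_insert hu] at h2
    exact h1 h2
  funext ⟨e, he⟩ T
  induction e using Sym2.ind with
  | _ u v =>
    rw [apply_eq_signedCoeff a T he, Pi.zero_apply, Pi.zero_apply]
    refine mul_eq_zero_of_right _ ?_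
    by_cases hu : u ∈ T.1 <;> by_cases hv : v ∈ T.1
    · exact signedCoeff_of_mem_of_mem ha hu hv
    · rw [signedCoeff_swap, key _ _ _ hv hu, neg_zero]
    · exact key _ _ _ hu hv
    · exact signedCoeff_of_notMem_of_notMem ha hu hv

end GraphicOT

namespace GraphicOT

variable {K : Type*} [Field K] {V : Type*} [DecidableEq V] {G : SimpleGraph V} [DecidableRel G.Adj]

section FaceUnit

variable (K G) in
/-- For a 4-clique `Q` with distinct vertices `u`, `v`, the vector with signed coordinate `1` at the
edge `uv` and the face of `Q` opposite to `u`, and all other coordinates zero. -/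
noncomputable def faceUnit (Q : Finset V) (u v : V) : G.edgeSet → Triangle G → K :=
  if h : G.IsNClique 3 (Q.erase u) ∧ G.Adj u v then
    sign K u v • Pi.single ⟨s(u, v), h.2⟩ (Pi.single ⟨Q.erase u, h.1⟩ 1)
  else 0

theorem faceUnit_eq {Q : Finset V} (hQ : G.IsNClique 4 Q) {u v : V} (hu : u ∈ Q) (hv : v ∈ Q)
    (huv : u ≠ v) : faceUnit K G Q u v =
      sign K u v • Pi.single ⟨s(u, v), hQ.isClique hu hv huv⟩
        (Pi.single ⟨Q.erase u, hQ.erase_of_mem hu⟩ 1) :=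
  dif_pos ⟨hQ.erase_of_mem hu, hQ.isClique hu hv huv⟩

theorem signedCoeff_faceUnit_self {Q : Finset V} (hQ : G.IsNClique 4 Q) {u v : V} (hu : u ∈ Q)
    (hv : v ∈ Q) (huv : u ≠ v) : signedCoeff (Q.erase u) u v (faceUnit K G Q u v) = 1 := by
  rw [signedCoeff_apply _ ⟨Q.erase u, hQ.erase_of_mem hu⟩ (hQ.isClique hu hv huv),
    faceUnit_eq hQ hu hv huv]
  simp [sign_mul_self]

theorem of_signedCoeff_faceUnit_ne_zero {Q Q' : Finset V} {u v u' v' : V} (hu : u ∈ Q) (hv : v ∈ Q)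
    (hu' : u' ∈ Q') (h : signedCoeff (Q'.erase u') u' v' (faceUnit K G Q u v) ≠ 0) :
    Q' = Q ∧ u' = u ∧ v' = v := by
  obtain ⟨hT, he⟩ := of_signedCoeff_ne_zero h
  rw [signedCoeff_apply _ ⟨Q'.erase u', hT⟩ he] at h
  replace h := right_ne_zero_of_mul h
  unfold faceUnit at h
  split_ifs at h with h1
  · rw [Pi.smul_apply, Pi.smul_apply] at h
    replace h := right_ne_zero_of_smul h
    have hedge : (⟨s(u', v'), he⟩ : G.edgeSet) = ⟨s(u, v), h1.2⟩ := by
      by_contra hne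
      rw [Pi.single_eq_of_ne hne] at h
      exact h rfl
    rw [hedge, Pi.single_eq_same] at h
    have hface : Q'.erase u' = Q.erase u := by
      by_contra hne
      rw [Pi.single_eq_of_ne fun h2 => hne (congrArg Subtype.val h2)] at h
      exact h rfl
    rcases Sym2.eq_iff.1 (congrArg Subtype.val hedge) with ⟨rfl, rfl⟩ | ⟨rfl, rfl⟩
    · refine ⟨?_, rfl, rfl⟩
      rw [← Finset.insert_erase hu', hface, Finset.insert_erase hu]
    · have hmem : u' ∈ Q.erase v' := Finset.mem_erase.2 ⟨h1.2.ne.symm, hv⟩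
      rw [← hface] at hmem
      exact (Finset.notMem_erase u' Q' hmem).elim
  · exact (h rfl).elim

variable [Fintype V] [Fintype (Triangle G)]

theorem linSyzMap_faceUnit {Q : Finset V} (hQ : G.IsNClique 4 Q) {w v x y : V}
    (h : IsEnum Q w v x y) : linSyzMap K G.edgeSet (quadric K G) (faceUnit K G Q w v) =
      edgeVar K G w v * triangleQuadric K G v x y := by
  have hw : w ∈ Q := h.mem_iff.2 (Or.inl rfl)
  have hv : v ∈ Q := h.mem_iff.2 (Or.inr (Or.inl rfl))
  have hwv := hQ.isClique hw hv h.ne₁₂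
  rw [← quadric_eq K G (T := ⟨Q.erase w, hQ.erase_of_mem hw⟩) h.erase_eq, faceUnit_eq hQ hw hv h.ne₁₂,
    edgeVar_of_adj K G hwv, map_smul, linSyzMap_apply, Finset.sum_eq_single ⟨s(w, v), hwv⟩,
    Finset.sum_eq_single ⟨Q.erase w, hQ.erase_of_mem hw⟩]
  · simp [smul_eq_C_mul, mul_assoc]
  · intro T _ hT
    simp [hT]
  · simp
  · intro e _ he
    simp [he]
  · simp

end FaceUnit

variable (K G) in
/-- The linear syzygy on the faces of the 4-clique `{w, v, x, y}` with parameters `s`, `t`. -/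
noncomputable def cliqueSyz (Q : Finset V) (w v x y : V) (s t : K) :
    G.edgeSet → Triangle G → K :=
  s • (faceUnit K G Q w v + faceUnit K G Q v w + faceUnit K G Q x y + faceUnit K G Q y x) +
    t • (faceUnit K G Q w x + faceUnit K G Q x w + faceUnit K G Q v y + faceUnit K G Q y v) +
    (-s - t) • (faceUnit K G Q w y + faceUnit K G Q y w + faceUnit K G Q v x + faceUnit K G Q x v)

theorem signedCoeff_cliqueSyz_of_ne {Q Q' : Finset V} {w v x y p q : V} (h : IsEnum Q w v x y)
    (hQ' : Q' ≠ Q) (hp : p ∈ Q') (s t : K) :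
    signedCoeff (Q'.erase p) p q (cliqueSyz K G Q w v x y s t) = 0 := by
  have key : ∀ {u v : V}, u ∈ Q → v ∈ Q →
      signedCoeff (Q'.erase p) p q (faceUnit K G Q u v) = 0 := fun hu hv => by
    by_contra h1
    exact hQ' (of_signedCoeff_faceUnit_ne_zero hu hv hp h1).1
  have hw : w ∈ Q := h.mem_iff.2 (by tauto)
  have hv : v ∈ Q := h.mem_iff.2 (by tauto)
  have hx : x ∈ Q := h.mem_iff.2 (by tauto)
  have hy : y ∈ Q := h.mem_iff.2 (by tauto)
  simp [cliqueSyz, key, hw, hv, hx, hy]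

theorem signedCoeff_cliqueSyz {Q : Finset V} (hQ : G.IsNClique 4 Q) {w v x y : V}
    (h : IsEnum Q w v x y) (s t : K) :
    signedCoeff (Q.erase w) w v (cliqueSyz K G Q w v x y s t) = s ∧
      signedCoeff (Q.erase w) w x (cliqueSyz K G Q w v x y s t) = t := by
  have hw : w ∈ Q := h.mem_iff.2 (by tauto)
  have hv : v ∈ Q := h.mem_iff.2 (by tauto)
  have hx : x ∈ Q := h.mem_iff.2 (by tauto)
  have hy : y ∈ Q := h.mem_iff.2 (by tauto)
  have key : ∀ {p q z : V}, p ∈ Q → q ∈ Q → ¬ (w = p ∧ z = q) →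
      signedCoeff (Q.erase w) w z (faceUnit K G Q p q) = 0 := fun hp hq hne => by
    by_contra h1
    exact hne (of_signedCoeff_faceUnit_ne_zero hp hq hw h1).2
  have hv1 := signedCoeff_faceUnit_self (K := K) hQ hw hv h.ne₁₂
  have hx1 := signedCoeff_faceUnit_self (K := K) hQ hw hx h.ne₁₃
  obtain ⟨-, h1, h2, h3, h4, h5, h6⟩ := h
  constructor
  · simp [cliqueSyz, key, hw, hv, hx, hy, hv1, h1, h2, h3, h4, h5]
  · simp [cliqueSyz, key, hw, hv, hx, hy, hx1, h1, h2, h3, h6, h4.symm]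

variable [Fintype V] [Fintype (Triangle G)]

theorem cliqueSyz_mem_ker {Q : Finset V} (hQ : G.IsNClique 4 Q) {w v x y : V}
    (h : IsEnum Q w v x y) (s t : K) :
    cliqueSyz K G Q w v x y s t ∈ LinearMap.ker (linSyzMap K G.edgeSet (quadric K G)) := by
  have hl := fun {w v x y : V} => linSyzMap_faceUnit (K := K) hQ (w := w) (v := v) (x := x) (y := y)
  have h1 := h.rotate
  have h2 := h1.rotate
  have h3 := h2.rotate
  rw [LinearMap.mem_ker, cliqueSyz]
  simp only [map_add, map_smul]
  rw [hl h, hl h.rotate_tail, hl h.rotate_tail.rotate_tail, hl h1, hl h1.rotate_tail,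
    hl h1.rotate_tail.rotate_tail, hl h2, hl h2.rotate_tail, hl h2.rotate_tail.rotate_tail,
    hl h3, hl h3.rotate_tail, hl h3.rotate_tail.rotate_tail]
  simp only [triangleQuadric, smul_eq_C_mul, C_sub, C_neg, edgeVar_swap K G w v,
    edgeVar_swap K G w x, edgeVar_swap K G w y, edgeVar_swap K G v x, edgeVar_swap K G v y,
    edgeVar_swap K G x y]
  ring

variable (K G) in
/-- The linear syzygies of the triangle quadrics have dimension twice the number of 4-cliques. -/
theorem finrank_ker_linSyzMap_quadric [Fintype {Q : Finset V // G.IsNClique 4 Q}] :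
    Module.finrank K (LinearMap.ker (linSyzMap K G.edgeSet (quadric K G))) =
      2 * Fintype.card {Q : Finset V // G.IsNClique 4 Q} := by
  choose p hp using fun Q : {Q : Finset V // G.IsNClique 4 Q} => exists_isEnum Q.2
  obtain ⟨Φ, hΦ⟩ : ∃ Φ : (G.edgeSet → Triangle G → K) →ₗ[K]
      ({Q : Finset V // G.IsNClique 4 Q} → K × K), ∀ a Q, Φ a Q =
        (signedCoeff (Q.1.erase (p Q).1) (p Q).1 (p Q).2.1 a,
          signedCoeff (Q.1.erase (p Q).1) (p Q).1 (p Q).2.2.1 a) :=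
    ⟨LinearMap.pi fun Q => (signedCoeff (Q.1.erase (p Q).1) (p Q).1 (p Q).2.1).prod
      (signedCoeff (Q.1.erase (p Q).1) (p Q).1 (p Q).2.2.1), fun _ _ => rfl⟩
  have hinj : Function.Injective
      (Φ.domRestrict (LinearMap.ker (linSyzMap K G.edgeSet (quadric K G)))) := by
    rw [← LinearMap.ker_eq_bot, LinearMap.ker_eq_bot']
    rintro ⟨a, ha⟩ h
    rw [LinearMap.domRestrict_apply] at h
    refine Subtype.ext (eq_zero_of_signedCoeff_erase ha fun Q hQ q hq r hr hqr => ?_)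
    have h1 := congrFun h ⟨Q, hQ⟩
    rw [hΦ, Pi.zero_apply, Prod.mk_eq_zero] at h1
    exact signedCoeff_erase_eq_zero ha (hp ⟨Q, hQ⟩) h1.1 h1.2 hq hr hqr
  have hsurj : Function.Surjective
      (Φ.domRestrict (LinearMap.ker (linSyzMap K G.edgeSet (quadric K G)))) := by
    intro t
    have hmem := Submodule.sum_mem (LinearMap.ker (linSyzMap K G.edgeSet (quadric K G)))
      (t := Finset.univ) fun Q _ => cliqueSyz_mem_ker Q.2 (hp Q) (t Q).1 (t Q).2
    refine ⟨⟨_, hmem⟩, ?_⟩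
    funext Q
    rw [LinearMap.domRestrict_apply, map_sum, Finset.sum_apply, Finset.sum_eq_single Q]
    · obtain ⟨h1, h2⟩ := signedCoeff_cliqueSyz Q.2 (hp Q) (t Q).1 (t Q).2
      rw [hΦ, h1, h2]
    · intro Q' _ hQ'
      have hne : Q.1 ≠ Q'.1 := fun h => hQ' (Subtype.ext h.symm)
      have hmem : (p Q).1 ∈ Q.1 := (hp Q).mem_iff.2 (Or.inl rfl)
      rw [hΦ, signedCoeff_cliqueSyz_of_ne (hp Q') hne hmem,
        signedCoeff_cliqueSyz_of_ne (hp Q') hne hmem, Prod.mk_zero_zero]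
    · simp
  rw [LinearEquiv.finrank_eq (LinearEquiv.ofBijective _ ⟨hinj, hsurj⟩), Module.finrank_pi_fintype]
  simp [mul_comm]

end GraphicOT

namespace GraphicOT

variable {V : Type*} [DecidableEq V]

theorem exists_mem_erase_iff {Q : Finset V} (hQ : 2 < Q.card) {c d : V} :
    ∃ z ∈ Q, (c ∈ Q.erase z ↔ d ∈ Q.erase z) := by
  by_cases hc : c ∈ Q <;> by_cases hd : d ∈ Q
  · obtain ⟨z, hz, hz1⟩ := Finset.exists_mem_notMem_of_card_lt_card
      (s := {c, d}) (t := Q) (Finset.card_le_two.trans_lt hQ)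
    simp only [Finset.mem_insert, Finset.mem_singleton, not_or] at hz1
    exact ⟨z, hz, by simp [hc, hd, Ne.symm hz1.1, Ne.symm hz1.2]⟩
  · exact ⟨c, hc, by simp [hd]⟩
  · exact ⟨d, hd, by simp [hc]⟩
  · obtain ⟨z, hz⟩ := Finset.card_pos.1 (pos_of_gt hQ)
    exact ⟨z, hz, by simp [hc, hd]⟩

theorem exists_isEnum_of_mem {Q : Finset V} (hQ : Q.card = 4) {p q : V} (hp : p ∈ Q) (hq : q ∈ Q)
    (hpq : p ≠ q) : ∃ x y, IsEnum Q p q x y := by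
  have hq' : q ∈ Q.erase p := Finset.mem_erase.2 ⟨hpq.symm, hq⟩
  have hcard : ((Q.erase p).erase q).card = 2 := by
    rw [Finset.card_erase_of_mem hq', Finset.card_erase_of_mem hp, hQ]
  obtain ⟨x, y, hxy, h⟩ := Finset.card_eq_two.1 hcard
  have h1 : Q = {p, q, x, y} := by rw [← h, Finset.insert_erase hq', Finset.insert_erase hp]
  have hx : x ∈ (Q.erase p).erase q := by simp [h]
  have hy : y ∈ (Q.erase p).erase q := by simp [h]
  simp only [Finset.mem_erase] at hx hy
  exact ⟨x, y, h1, hpq, hx.2.1.symm, hy.2.1.symm, hx.1.symm, hy.1.symm, hxy⟩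

variable {K : Type*} [Field K] [Fintype V] {G : SimpleGraph V} [DecidableRel G.Adj]
  [Fintype (Triangle G)]

/-- If an alternating family consists of linear syzygies, its member at the edge `cd` has zero
signed coordinate at every triangle containing both or none of `c`, `d`. -/
theorem signedCoeff_eq_zero_of_alternating {s : G.edgeSet → G.edgeSet → Triangle G → K}
    (hs : ∀ f, s f ∈ LinearMap.ker (linSyzMap K G.edgeSet (quadric K G)))
    (hsymm : ∀ e f, s e f + s f e = 0) {c d : V} (hcd : G.Adj c d) {T : Finset V} (u v : V)
    (hT : c ∈ T ↔ d ∈ T) : signedCoeff T u v (s ⟨s(c, d), hcd⟩) = 0 := by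
  by_contra h
  obtain ⟨hT3, huv⟩ := of_signedCoeff_ne_zero h
  have h1 : signedCoeff T c d (s ⟨s(u, v), huv⟩) = 0 := by
    by_cases hc : c ∈ T
    · exact signedCoeff_of_mem_of_mem (hs _) hc (hT.1 hc)
    · exact signedCoeff_of_notMem_of_notMem (hs _) hc fun hd => hc (hT.2 hd)
  have h2 := apply_eq_signedCoeff (s ⟨s(u, v), huv⟩) ⟨T, hT3⟩ hcd
  have h3 := congrFun (hsymm ⟨s(u, v), huv⟩ ⟨s(c, d), hcd⟩) ⟨T, hT3⟩
  rw [Pi.add_apply, h2, h1, mul_zero, zero_add, Pi.zero_apply] at h3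
  exact h (by rw [signedCoeff_apply _ ⟨T, hT3⟩ huv, h3, mul_zero])

theorem eq_zero_of_alternating {s : G.edgeSet → G.edgeSet → Triangle G → K}
    (hs : ∀ f, s f ∈ LinearMap.ker (linSyzMap K G.edgeSet (quadric K G)))
    (hsymm : ∀ e f, s e f + s f e = 0) : s = 0 := by
  funext f
  obtain ⟨f, hf⟩ := f
  induction f using Sym2.ind with | h c d
  refine eq_zero_of_signedCoeff_erase (hs _) fun Q hQ p hp q hq hpq => ?_
  obtain ⟨x, y, h⟩ := exists_isEnum_of_mem hQ.card_eq hp hq hpq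
  obtain ⟨z, hz, hz1⟩ := exists_mem_erase_iff (Q := Q) (c := c) (d := d) (by rw [hQ.card_eq]; lia)
  have key := fun u v => signedCoeff_eq_zero_of_alternating hs hsymm (T := Q.erase z) hf u v hz1
  rcases h.mem_iff.1 hz with rfl | rfl | rfl | rfl
  · exact key _ _
  · exact (signedCoeff_erase_swap (hs _) h).trans (key _ _)
  · exact (signedCoeff_erase_eq (hs _) h).trans (key _ _)
  · exact ((signedCoeff_erase_eq (hs _) h).trans
      (signedCoeff_erase_swap (hs _) h.rotate.rotate)).trans (key _ _)

end GraphicOT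

open GraphicOT

/-- Let `G` be a simple graph with Orlik-Terao ideal
`I_G ⊆ R = K[y_e : e ∈ E(G)]`, and let `κ_i` be the number of induced complete subgraphs of
`G` isomorphic to `K_{i+1}` (i.e. `(i+1)`-cliques).  Then the linear strand of the minimal
free resolution of `R/I_G` is: `dim_K Tor_1(R/I_G, K)_2 = κ_2`,
`dim_K Tor_2(R/I_G, K)_3 = 2 κ_3`, and `dim_K Tor_i(R/I_G, K)_{i+1} = 0` for `i ≥ 3`. -/
theorem graphOTIdeal_linear_strand
    (K : Type*) [Field K] {V : Type*} [Fintype V] [DecidableEq V]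
    (G : SimpleGraph V) [DecidableRel G.Adj] :
    ∃ res : MinGradedFreeRes K G.edgeSet (graphOTIdeal K G),
      (Finset.univ.filter fun r => res.deg 1 r = 2).card =
        Set.ncard {s : Finset V | G.IsNClique 3 s} ∧
      (Finset.univ.filter fun r => res.deg 2 r = 3).card =
        2 * Set.ncard {s : Finset V | G.IsNClique 4 s} ∧
      ∀ i, 3 ≤ i → (Finset.univ.filter fun r => res.deg i r = i + 1).card = 0 := by
  classical
  have := Fintype.ofFinite (Triangle G)
  have := Fintype.ofFinite {Q : Finset V // G.IsNClique 4 Q}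
  have hcard : ∀ n, Nat.card {Q : Finset V // G.IsNClique n Q} =
      Set.ncard {Q : Finset V | G.IsNClique n Q} := fun n => rfl
  rw [← hcard, ← hcard, Nat.card_eq_fintype_card, Nat.card_eq_fintype_card,
    ← finrank_ker_linSyzMap_quadric K G]
  refine exists_minGradedFreeRes_of_span ?_ (linearIndependent_quadric K G)
    (fun T => ⟨quadric_mem T, quadric_isHomogeneous K G T⟩) ?_
    fun s hs hsymm _ => eq_zero_of_alternating hs hsymm
  · rintro _ ⟨c, hc, rfl⟩
    exact exists_isHomogeneous_otgen hc
  · rintro _ ⟨c, hc, rfl⟩ h2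
    exact otgen_mem_span_quadric hc h2
end

section
/- Let A be an essential central arrangement of d hyperplanes of rank n with Orlik–Terao ideal I ⊆ R = K[y_1,…,y_d]. Then the Hilbert series of the Orlik–Terao algebra R/I is HS(R/I, t) = P(A, t/(1−t)), where P(A, t) is the Poincaré polynomial of A. -/
open MvPolynomial

/-- The degree-`m` graded piece of `R/I`, the image of the homogeneous polynomials of
degree `m` in the quotient. -/
noncomputable def quotGradedPiece {K ι : Type*} [Field K] [Fintype ι]
    (I : Ideal (MvPolynomial ι K)) (m : ℕ) : Submodule K (MvPolynomial ι K ⧸ I) :=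
  Submodule.map (Ideal.Quotient.mkₐ K I).toLinearMap (MvPolynomial.homogeneousSubmodule ι K m)


namespace CentralArrangement

variable {K : Type*} [Field K] {ι : Type*} [Fintype ι] {n : ℕ}

/-- A flat of the arrangement (an element of the intersection lattice `L(A)`), encoded by
the closed set `S = {i | X ⊆ H_i}` of hyperplanes containing it. -/
def IsFlat (A : CentralArrangement K ι n) (S : Finset ι) : Prop :=
  ∀ j, A.form j ∈ Submodule.span K (A.form '' S) → j ∈ S

/-- The rank `r(X)` (codimension) of a flat. -/
noncomputable def flatRank (A : CentralArrangement K ι n) (S : Finset ι) : ℕ :=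
  Module.finrank K ↥(Submodule.span K (A.form '' S))

open Classical in
/-- The Möbius function `μ(0̂, X)` of the intersection lattice `L(A)`, where the bottom
element `0̂` is the empty flat (the whole space `K^n`), defined by the usual recursion
`μ(0̂) = 1` and `Σ_{T ≤ X} μ(0̂, T) = 0` for `X > 0̂`. -/
noncomputable def mobius (A : CentralArrangement K ι n) : Finset ι → ℤ
  | S =>
    if S = ∅ then 1
    else - ∑ T ∈ (S.powerset.filter fun T => T ≠ S ∧ A.IsFlat T).attach,
      have : T.1.card < S.card := by
        have hmem := Finset.mem_filter.mp T.2
        have hsub := Finset.mem_powerset.mp hmem.1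
        exact Finset.card_lt_card (lt_of_le_of_ne hsub hmem.2.1)
      mobius A T.1
  termination_by S => S.card

end CentralArrangement

/-- A set `T` of indices is nbc (no broken circuit) for the family `v` if no `v j` lies in the
span of the `v i` with `i ∈ T` and `j < i`. -/
def IsNBC (K : Type*) {V ι : Type*} [Field K] [AddCommGroup V] [Module K V] [LinearOrder ι]
    (v : ι → V) (T : Finset ι) : Prop :=
  ∀ j, v j ∉ Submodule.span K (v '' {i | i ∈ T ∧ j < i})

section LinearForms

variable {K κ : Type*} [Field K] [Fintype κ]

/-- The linear form with coefficient vector `v`, as a polynomial. -/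
noncomputable def linForm : (κ → K) →ₗ[K] MvPolynomial κ K :=
  Fintype.linearCombination K X

lemma linForm_injective : Function.Injective (linForm : (κ → K) →ₗ[K] MvPolynomial κ K) :=
  linearIndependent_iff_injective_fintypeLinearCombination.1 (linearIndependent_X κ K)

open Classical in
/-- Linear endomorphisms of the space of linear forms extend to the polynomial ring. -/
lemma exists_algHom_linForm (P : (κ → K) →ₗ[K] (κ → K)) :
    ∃ φ : MvPolynomial κ K →ₐ[K] MvPolynomial κ K, ∀ v, φ (linForm v) = linForm (P v) := by
  refine ⟨aeval fun i => linForm (P (Pi.single i 1)), fun v => ?_⟩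
  conv_rhs => rw [pi_eq_sum_univ' v]
  simp only [linForm, Fintype.linearCombination_apply, map_sum, map_smul, aeval_X]

/-- There is an endomorphism whose kernel is the line spanned by a given vector. -/
lemma exists_linearMap_ker_eq_span_singleton {V : Type*} [AddCommGroup V] [Module K V] (x : V) :
    ∃ P : V →ₗ[K] V, LinearMap.ker P = Submodule.span K {x} := by
  obtain ⟨q, hq⟩ := Submodule.exists_isCompl (Submodule.span K {x})
  exact ⟨q.subtype ∘ₗ Submodule.projectionOnto q _ hq.symm, by
    rw [LinearMap.ker_comp_of_ker_eq_bot _ q.ker_subtype, Submodule.ker_projectionOnto]⟩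

variable {ι β : Type*} [LinearOrder ι]

/-- Linear independence of the nbc monomials in the reciprocals of linear forms, after clearing
denominators. -/
lemma nbc_coeff_eq_zero (s : Finset ι) (v : ι → κ → K) (N : ℕ) (e : β → ι → ℕ) (g : β → K)
    (B : Finset β) (hN : ∀ a ∈ B, ∀ i ∈ s, e a i ≤ N)
    (hinj : ∀ a ∈ B, ∀ b ∈ B, (∀ i ∈ s, e a i = e b i) → a = b)
    (hnbc : ∀ a ∈ B, ∀ j ∈ s, v j ∉ Submodule.span K (v '' {i | i ∈ s ∧ j < i ∧ e a i ≠ 0}))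
    (hsum : ∑ a ∈ B, g a • ∏ i ∈ s, linForm (v i) ^ (N - e a i) = 0) :
    ∀ a ∈ B, g a = 0 := by
  classical
  induction s using Finset.induction_on_max generalizing v B with
  | empty =>
    intro a ha
    have hB : B = {a} := Finset.eq_singleton_iff_unique_mem.2
      ⟨ha, fun b hb => hinj b hb a ha (by simp)⟩
    have h1 : (1 : MvPolynomial κ K) ≠ 0 := one_ne_zero
    simpa [hB, h1] using hsum
  | insert n s hn ih =>
    have hns : n ∉ s := fun h => lt_irrefl _ (hn n h)
    by_contra! hne
    set B' := B.filter fun a => g a ≠ 0 with hB'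
    have hB'ne : B'.Nonempty := by
      obtain ⟨a, ha, hga⟩ := hne
      exact ⟨a, by simp [hB', ha, hga]⟩
    obtain ⟨a₀, ha₀, hmax⟩ := B'.exists_max_image (fun a => e a n) hB'ne
    have ha₀B := (Finset.mem_filter.1 ha₀).1
    set M := e a₀ n with hM
    have hMN : M ≤ N := hN a₀ ha₀B n (by simp)
    have hvn : v n ≠ 0 := fun h =>
      hnbc a₀ ha₀B n (by simp) (by rw [h]; exact Submodule.zero_mem _)
    have hln : linForm (v n) ≠ (0 : MvPolynomial κ K) := fun h =>
      hvn (linForm_injective (h.trans (map_zero _).symm))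
    have hsum' : ∑ a ∈ B', g a • (linForm (v n) ^ (M - e a n) *
        ∏ i ∈ s, linForm (v i) ^ (N - e a i)) = 0 := by
      apply mul_left_cancel₀ (pow_ne_zero (N - M) hln)
      rw [mul_zero, ← hsum, ← Finset.sum_filter_of_ne (s := B) (p := fun a => g a ≠ 0),
        Finset.mul_sum]
      · refine Finset.sum_congr rfl fun a ha => ?_
        rw [Finset.prod_insert hns, mul_smul_comm, ← mul_assoc, ← pow_add]
        have := hmax a ha
        congr 4
        lia
      · intro a _ h hg
        simp [hg] at h
    obtain ⟨P, hP0, hPs⟩ : ∃ P : (κ → K) →ₗ[K] (κ → K), (M ≠ 0 → P (v n) = 0) ∧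
        ∀ x, P x = 0 → x ∈ Submodule.span K (v '' {i | i = n ∧ M ≠ 0}) := by
      by_cases hM0 : M = 0
      · exact ⟨LinearMap.id, by simp [hM0], by simp [hM0]⟩
      · obtain ⟨P, hP⟩ := exists_linearMap_ker_eq_span_singleton (K := K) (v n)
        refine ⟨P, fun _ => ?_, fun x hx => ?_⟩
        · rw [← LinearMap.mem_ker, hP]
          exact Submodule.mem_span_singleton_self _
        · simpa [hM0, ← hP] using hx
    obtain ⟨φ, hφ⟩ := exists_algHom_linForm P
    refine (Finset.mem_filter.1 ha₀).2 (ih (fun i => P (v i)) (B'.filter fun a => e a n = M)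
      ?_ ?_ ?_ ?_ a₀ (by simp [ha₀, hM]))
    · intro a ha i hi
      simp only [hB', Finset.mem_filter] at ha
      exact hN a ha.1.1 i (by simp [hi])
    · intro a ha b hb h
      simp only [hB', Finset.mem_filter] at ha hb
      refine hinj a ha.1.1 b hb.1.1 fun i hi => ?_
      obtain rfl | hi := Finset.mem_insert.1 hi
      · rw [ha.2, hb.2]
      · exact h i hi
    · intro a ha j hj hmem
      simp only [hB', Finset.mem_filter] at ha
      refine hnbc a ha.1.1 j (by simp [hj]) ?_
      rw [← Function.comp_def P v, Set.image_comp, ← Submodule.map_span] at hmem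
      obtain ⟨w, hw, hPw⟩ := hmem
      have h1 := hPs (v j - w) (by rw [map_sub, hPw, sub_self])
      rw [← sub_add_cancel (v j) w]
      refine Submodule.add_mem _ (Submodule.span_mono (Set.image_mono ?_) h1)
        (Submodule.span_mono (Set.image_mono ?_) hw)
      · rintro i ⟨rfl, hM0⟩
        exact ⟨by simp, hn j hj, by rw [ha.2]; exact hM0⟩
      · rintro i ⟨his, hi⟩
        exact ⟨by simp [his], hi⟩
    · have := congrArg φ hsum'
      rw [map_zero, map_sum] at this
      rw [← this, Finset.sum_filter]
      refine Finset.sum_congr rfl fun a ha => ?_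
      have hle := hmax a ha
      simp only [map_smul, map_mul, map_pow, map_prod, hφ]
      split_ifs with h
      · simp [h]
      · rw [hP0 (by lia), map_zero, zero_pow (by lia)]
        simp

end LinearForms

section Combinatorics

variable {K V ι : Type*} [Field K] [AddCommGroup V] [Module K V] [LinearOrder ι] {v : ι → V}

lemma IsNBC.mono {S T : Finset ι} (hT : IsNBC K v T) (h : S ⊆ T) : IsNBC K v S := by
  refine fun j hj => hT j (Submodule.span_mono (Set.image_mono ?_) hj)
  exact fun i hi => ⟨h hi.1, hi.2⟩

lemma IsNBC.linearIndepOn {T : Finset ι} (hT : IsNBC K v T) : LinearIndepOn K v (T : Set ι) := by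
  induction T using Finset.induction_on_min with
  | empty => simp
  | insert a s ha ih =>
    rw [Finset.coe_insert, linearIndepOn_insert (fun h => lt_irrefl a (ha a h))]
    refine ⟨ih (hT.mono (Finset.subset_insert _ _)), fun h => hT a ?_⟩
    refine Submodule.span_mono (Set.image_mono fun i hi => ?_) h
    exact ⟨Finset.mem_insert_of_mem hi, ha i hi⟩

end Combinatorics

namespace CentralArrangement

variable {K ι : Type*} [Field K] [Fintype ι] {n : ℕ} (A : CentralArrangement K ι n)

open Classical in
/-- The smallest flat containing a set of hyperplanes. -/
noncomputable def flatClosure (T : Finset ι) : Finset ι :=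
  Finset.univ.filter fun j => A.form j ∈ Submodule.span K (A.form '' T)

variable {A}

lemma mem_flatClosure {T : Finset ι} {j : ι} :
    j ∈ A.flatClosure T ↔ A.form j ∈ Submodule.span K (A.form '' T) := by
  simp [flatClosure]

lemma subset_flatClosure (T : Finset ι) : T ⊆ A.flatClosure T := fun j hj =>
  mem_flatClosure.2 (Submodule.subset_span ⟨j, hj, rfl⟩)

lemma span_flatClosure (T : Finset ι) :
    Submodule.span K (A.form '' A.flatClosure T) = Submodule.span K (A.form '' T) := by
  refine le_antisymm (Submodule.span_le.2 ?_)
    (Submodule.span_mono (Set.image_mono (subset_flatClosure T)))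
  rintro _ ⟨j, hj, rfl⟩
  exact mem_flatClosure.1 hj

lemma isFlat_flatClosure (T : Finset ι) : A.IsFlat (A.flatClosure T) := fun j hj =>
  mem_flatClosure.2 (by rwa [span_flatClosure] at hj)

lemma IsFlat.flatClosure_subset_iff {S T : Finset ι} (hS : A.IsFlat S) :
    A.flatClosure T ⊆ S ↔ T ⊆ S :=
  ⟨(subset_flatClosure T).trans, fun h j hj =>
    hS j (Submodule.span_mono (Set.image_mono h) (mem_flatClosure.1 hj))⟩

lemma isFlat_empty : A.IsFlat ∅ := fun j hj => (A.nonzero j (by simpa using hj)).elim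

variable [LinearOrder ι]

lemma flatRank_flatClosure {T : Finset ι} (hT : IsNBC K A.form T) :
    A.flatRank (A.flatClosure T) = T.card := by
  rw [flatRank, span_flatClosure, Set.image_eq_range,
    finrank_span_eq_card (b := fun i : (T : Set ι) => A.form i) hT.linearIndepOn]
  simp

open Classical in
/-- Inserting or removing the smallest hyperplane of a nonempty flat pairs off its nbc subsets. -/
lemma sum_nbc_subset_eq_zero {S : Finset ι} (hS : A.IsFlat S) (hne : S.Nonempty) :
    ∑ T : Finset ι with IsNBC K A.form T ∧ T ⊆ S, (-1 : ℤ) ^ T.card = 0 := by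
  set a := S.min' hne with ha
  have haS : a ∈ S := S.min'_mem hne
  refine Finset.sum_involution (fun T _ => if a ∈ T then T.erase a else insert a T) ?_ ?_ ?_ ?_
  · intro T _
    split_ifs with h
    · rw [← Finset.card_erase_add_one h]
      ring
    · rw [Finset.card_insert_of_notMem h]
      ring
  · intro T _ _
    split_ifs with h
    · simpa using h
    · simpa using h
  · intro T hT
    simp only [Finset.mem_filter, Finset.mem_univ, true_and] at hT ⊢
    split_ifs with h
    · exact ⟨hT.1.mono (Finset.erase_subset _ _), (Finset.erase_subset _ _).trans hT.2⟩
    · have hsub : insert a T ⊆ S := Finset.insert_subset haS hT.2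
      refine ⟨fun j hj => ?_, hsub⟩
      by_cases hja : j < a
      · have hjS : j ∈ S := hS j
          (Submodule.span_mono (Set.image_mono fun i hi => hsub hi.1) hj)
        exact absurd (S.min'_le j hjS) (not_le.2 hja)
      · refine hT.1 j (Submodule.span_mono (Set.image_mono ?_) hj)
        rintro i ⟨hi, hji⟩
        obtain rfl | hi := Finset.mem_insert.1 hi
        · exact absurd hji hja
        · exact ⟨hi, hji⟩
  · intro T _
    by_cases h : a ∈ T <;> simp [h]

open Classical in
/-- Whitney's theorem: the Möbius function of a flat counts, up to sign, its nbc bases. -/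
lemma mobius_eq_sum_nbc {S : Finset ι} (hS : A.IsFlat S) :
    A.mobius S = ∑ T : Finset ι with IsNBC K A.form T ∧ A.flatClosure T = S, (-1) ^ T.card := by
  induction S using Finset.strongInduction with
  | H S ih =>
    rw [mobius]
    split_ifs with h0
    · subst h0
      rw [Finset.sum_eq_single_of_mem ∅]
      · simp
      · have hcl : A.flatClosure ∅ = ∅ :=
          Finset.subset_empty.1 (isFlat_empty.flatClosure_subset_iff.2 subset_rfl)
        simp only [Finset.mem_filter, Finset.mem_univ, true_and, hcl, and_true]
        intro j hj
        exact A.nonzero j (by simpa using hj)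
      · intro T hT hT0
        simp only [Finset.mem_filter, Finset.mem_univ, true_and] at hT
        exact absurd (Finset.subset_empty.1 (hT.2 ▸ subset_flatClosure T)) hT0
    · dsimp only
      rw [Finset.sum_attach _ A.mobius,
        neg_eq_iff_add_eq_zero,
        ← sum_nbc_subset_eq_zero hS (Finset.nonempty_iff_ne_empty.2 h0),
        ← Finset.sum_fiberwise_of_maps_to
          (s := Finset.univ.filter fun T => IsNBC K A.form T ∧ T ⊆ S)
          (t := S.powerset.filter A.IsFlat) (g := A.flatClosure)]
      · have hfib : ∀ F ∈ S.powerset.filter A.IsFlat,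
            ∑ T ∈ (Finset.univ.filter fun T => IsNBC K A.form T ∧ T ⊆ S) with
              A.flatClosure T = F, (-1 : ℤ) ^ T.card =
            ∑ T : Finset ι with IsNBC K A.form T ∧ A.flatClosure T = F, (-1) ^ T.card := by
          intro F hF
          simp only [Finset.mem_filter, Finset.mem_powerset] at hF
          refine Finset.sum_congr ?_ fun _ _ => rfl
          ext T
          simp only [Finset.mem_filter, Finset.mem_univ, true_and]
          refine ⟨fun h => ⟨h.1.1, h.2⟩, fun h => ⟨⟨h.1, ?_⟩, h.2⟩⟩
          exact (subset_flatClosure T).trans (h.2 ▸ hF.1)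
        rw [Finset.sum_congr rfl hfib]
        have hsplit : S.powerset.filter A.IsFlat =
            insert S (S.powerset.filter fun T => T ≠ S ∧ A.IsFlat T) := by
          ext T
          simp only [Finset.mem_filter, Finset.mem_powerset, Finset.mem_insert]
          by_cases h : T = S <;> simp [h, hS]
        rw [hsplit, Finset.sum_insert (by simp), add_comm]
        congr 1
        refine Finset.sum_congr (by congr!) fun T hT => ?_
        simp only [Finset.mem_filter, Finset.mem_powerset] at hT
        exact ih T (hT.1.ssubset_of_ne hT.2.1) hT.2.2
      · intro T hT
        simp only [Finset.mem_filter, Finset.mem_univ, true_and, Finset.mem_powerset] at hT ⊢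
        exact ⟨hS.flatClosure_subset_iff.2 hT.2, isFlat_flatClosure T⟩

open Classical in
/-- The Poincaré polynomial as the generating function of nbc sets by cardinality. -/
lemma sum_flats_eq_sum_nbc (u : PowerSeries ℚ) :
    ∑ S : Finset ι with A.IsFlat S, (A.mobius S : PowerSeries ℚ) * (-u) ^ A.flatRank S =
      ∑ T : Finset ι with IsNBC K A.form T, u ^ T.card := by
  rw [← Finset.sum_fiberwise_of_maps_to (s := Finset.univ.filter (IsNBC K A.form))
    (t := Finset.univ.filter A.IsFlat) (g := A.flatClosure)
    (fun T _ => by simpa using isFlat_flatClosure T)]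
  refine Finset.sum_congr rfl fun S hS => ?_
  rw [mobius_eq_sum_nbc (by simpa using hS), Finset.filter_filter, Int.cast_sum, Finset.sum_mul]
  refine Finset.sum_congr rfl fun T hT => ?_
  simp only [Finset.mem_filter, Finset.mem_univ, true_and] at hT
  rw [← hT.2, flatRank_flatClosure hT.1]
  push_cast
  rw [← mul_pow]
  simp

end CentralArrangement

open Classical in
/-- The squarefree support decomposition of the Hilbert function of a Stanley-Reisner ring. -/
lemma powerSeries_mk_card_eq_sum {ι : Type*} [Fintype ι] [DecidableEq ι] (p : Finset ι → Prop) :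
    (PowerSeries.mk fun m =>
      (((Finset.finsuppAntidiag Finset.univ m).filter fun a : ι →₀ ℕ => p a.support).card : ℚ)) =
      ∑ T : Finset ι with p T,
        ((PowerSeries.X : PowerSeries ℚ) * (1 - PowerSeries.X : PowerSeries ℚ)⁻¹) ^ T.card := by
  ext m
  have hgeom : (PowerSeries.X : PowerSeries ℚ) * (1 - PowerSeries.X : PowerSeries ℚ)⁻¹ =
      PowerSeries.mk fun k => if k = 0 then 0 else 1 := by
    symm
    rw [PowerSeries.eq_mul_inv_iff_mul_eq (by simp)]
    ext k
    rw [mul_sub, mul_one, map_sub]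
    rcases k with - | - | k
    · simp
    · simp [PowerSeries.coeff_succ_mul_X]
    · simp [PowerSeries.coeff_succ_mul_X, PowerSeries.coeff_X]
  rw [hgeom, PowerSeries.coeff_mk, map_sum,
    Finset.card_eq_sum_card_fiberwise (f := Finsupp.support) (t := Finset.univ.filter p)
      (fun a ha => by simpa using (Finset.mem_filter.1 ha).2), Nat.cast_sum]
  refine Finset.sum_congr rfl fun T hT => ?_
  rw [← Finset.prod_const, PowerSeries.coeff_prod, Finset.card_filter, Nat.cast_sum]
  simp only [PowerSeries.coeff_mk]
  have hprod : ∀ l : ι →₀ ℕ, (∏ i ∈ T, if l i = 0 then (0 : ℚ) else 1) =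
      if T ⊆ l.support then 1 else 0 := by
    intro l
    split_ifs with h
    · exact Finset.prod_eq_one fun i hi => if_neg (Finsupp.mem_support_iff.1 (h hi))
    · obtain ⟨i, hi, hil⟩ := Finset.not_subset.1 h
      exact Finset.prod_eq_zero hi (if_pos (Finsupp.notMem_support_iff.1 hil))
  simp only [hprod, Nat.cast_ite, Nat.cast_one, Nat.cast_zero]
  rw [← Finset.sum_filter, ← Finset.sum_filter]
  refine Finset.sum_congr ?_ fun _ _ => rfl
  ext l
  simp only [Finset.mem_filter, Finset.mem_univ, true_and, Finset.mem_finsuppAntidiag] at hT ⊢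
  constructor
  · rintro ⟨⟨⟨h1, -⟩, -⟩, rfl⟩
    refine ⟨⟨?_, subset_rfl⟩, subset_rfl⟩
    rw [← h1]
    exact Finset.sum_subset (Finset.subset_univ _) fun i _ hi => Finsupp.notMem_support_iff.1 hi
  · rintro ⟨⟨h1, h2⟩, h3⟩
    obtain rfl := h2.antisymm h3
    refine ⟨⟨⟨?_, Finset.subset_univ _⟩, hT⟩, rfl⟩
    rw [← h1]
    exact (Finset.sum_subset (Finset.subset_univ _)
      fun i _ hi => Finsupp.notMem_support_iff.1 hi).symm

namespace CentralArrangement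

variable {K : Type*} [Field K] {d n : ℕ} (A : CentralArrangement K (Fin d) n)

/-- The evaluation `y_i ↦ 1 / α_i`. -/
noncomputable def recipHom :
    MvPolynomial (Fin d) K →ₐ[K] FractionRing (MvPolynomial (Fin n) K) :=
  aeval fun i => (algebraMap (MvPolynomial (Fin n) K) _ (linForm (A.form i)))⁻¹

lemma algebraMap_fractionRing_smul {σ : Type*} (r : K) (p : MvPolynomial σ K) :
    algebraMap _ (FractionRing (MvPolynomial σ K)) (r • p) =
      r • algebraMap _ (FractionRing (MvPolynomial σ K)) p :=
  map_smul (IsScalarTower.toAlgHom K (MvPolynomial σ K) (FractionRing (MvPolynomial σ K))) r p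

lemma algebraMap_linForm_ne_zero (i : Fin d) :
    algebraMap (MvPolynomial (Fin n) K) (FractionRing (MvPolynomial (Fin n) K))
      (linForm (A.form i)) ≠ 0 := by
  rw [Ne, IsFractionRing.to_map_eq_zero_iff]
  exact fun h => A.nonzero i (linForm_injective (h.trans (map_zero _).symm))

lemma recipHom_otgen {c : Fin d → K} (hc : c ∈ A.relSpace) : A.recipHom (otgen c) = 0 := by
  set x : Fin d → FractionRing (MvPolynomial (Fin n) K) := fun i => algebraMap _ _
    (linForm (A.form i)) with hx
  have hx0 : ∀ i, x i ≠ 0 := A.algebraMap_linForm_ne_zero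
  have hrel : ∑ i, c i • x i = 0 := by
    have h : ∑ i, c i • A.form i = 0 := hc
    have := congrArg (fun v => algebraMap _ (FractionRing (MvPolynomial (Fin n) K))
      (linForm v)) h
    simpa [hx, algebraMap_fractionRing_smul] using this
  have hterm : ∀ j ∈ vsupp c,
      A.recipHom (C (c j) * ∏ l ∈ (vsupp c).erase j, MvPolynomial.X l) =
        (∏ l ∈ vsupp c, (x l)⁻¹) * (c j • x j) := by
    intro j hj
    rw [← Finset.mul_prod_erase _ _ hj, ← MvPolynomial.algebraMap_eq, ← Algebra.smul_def,
      map_smul, map_prod]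
    simp only [recipHom, aeval_X]
    rw [mul_smul_comm, mul_right_comm, inv_mul_cancel₀ (hx0 j), one_mul]
  rw [otgen, map_sum, Finset.sum_congr rfl hterm, ← Finset.mul_sum]
  rw [Finset.sum_subset (Finset.subset_univ _), hrel, mul_zero]
  intro j _ hj
  have : c j = 0 := by simpa [vsupp] using hj
  rw [this, zero_smul]

lemma recipHom_eq_zero_of_mem {f : MvPolynomial (Fin d) K} (hf : f ∈ A.otIdeal) :
    A.recipHom f = 0 := by
  have h : A.otIdeal ≤ RingHom.ker A.recipHom := by
    rw [otIdeal, Ideal.span_le]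
    rintro _ ⟨c, hc, rfl⟩
    exact A.recipHom_otgen hc
  exact h hf

/-- The residue class of a monomial in the Orlik-Terao algebra. -/
noncomputable def monomialClass (a : Fin d →₀ ℕ) : MvPolynomial (Fin d) K ⧸ A.otIdeal :=
  Ideal.Quotient.mkₐ K A.otIdeal (monomial a 1)

lemma linearIndepOn_monomialClass (B : Finset (Fin d →₀ ℕ))
    (hB : ∀ a ∈ B, IsNBC K A.form a.support) :
    LinearIndepOn K A.monomialClass (B : Set (Fin d →₀ ℕ)) := by
  rw [linearIndepOn_finset_iff]
  intro g hg
  have hmem : ∑ a ∈ B, g a • monomial a (1 : K) ∈ A.otIdeal := by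
    rw [← Ideal.Quotient.eq_zero_iff_mem, ← Ideal.Quotient.mkₐ_eq_mk K, ← hg, map_sum]
    simp only [map_smul, monomialClass]
  have hzero := A.recipHom_eq_zero_of_mem hmem
  set N := ∑ a ∈ B, a.degree with hN
  have hle : ∀ a ∈ B, ∀ i, a i ≤ N := fun a ha i =>
    (Finsupp.le_degree i a).trans (Finset.single_le_sum (f := fun a => a.degree)
      (fun _ _ => Nat.zero_le _) ha)
  refine nbc_coeff_eq_zero Finset.univ A.form N (fun a i => a i) g B (fun a ha i _ => hle a ha i)
    (fun a _ b _ h => Finsupp.ext fun i => h i (Finset.mem_univ i)) ?_ ?_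
  · intro a ha j _ hj
    refine hB a ha j (Submodule.span_mono (Set.image_mono ?_) hj)
    rintro i ⟨-, hji, hi⟩
    exact ⟨by simpa using hi, hji⟩
  · apply IsFractionRing.injective (MvPolynomial (Fin n) K)
      (FractionRing (MvPolynomial (Fin n) K))
    rw [map_zero, ← mul_zero (∏ i, algebraMap (MvPolynomial (Fin n) K) (FractionRing
      (MvPolynomial (Fin n) K)) (linForm (A.form i)) ^ N), ← hzero, map_sum, map_sum,
      Finset.mul_sum]
    refine Finset.sum_congr rfl fun a ha => ?_
    rw [algebraMap_fractionRing_smul, map_smul, recipHom, aeval_monomial, map_one, one_mul,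
      mul_smul_comm,
      Finsupp.prod_fintype _ _ (fun _ => pow_zero _), ← Finset.prod_mul_distrib, map_prod]
    congr 1
    refine Finset.prod_congr rfl fun i _ => ?_
    rw [map_pow, inv_pow, pow_sub₀ _ (A.algebraMap_linForm_ne_zero i) (hle a ha i)]

lemma prod_X_eq_monomial {σ : Type*} (s : Finset σ) :
    ∏ l ∈ s, (MvPolynomial.X l : MvPolynomial σ K) =
      monomial (∑ l ∈ s, Finsupp.single l 1) 1 := by
  rw [monomial_sum_one]
  rfl

/-- Rewriting a monomial whose support is not nbc in terms of monomials obtained by replacing a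
variable by one with a smaller index. -/
lemma monomialClass_mem_span_of_not_isNBC {a : Fin d →₀ ℕ} (ha : ¬ IsNBC K A.form a.support) :
    A.monomialClass a ∈ Submodule.span K
      (A.monomialClass '' {b | ∃ j k, j < k ∧ b + Finsupp.single k 1 = a + Finsupp.single j 1}) := by
  obtain ⟨j, hj⟩ : ∃ j, A.form j ∈
      Submodule.span K (A.form '' {i | i ∈ a.support ∧ j < i}) := by
    simpa [IsNBC] using ha
  set U := a.support.filter fun i => j < i with hU
  have hjU : j ∉ U := by simp [hU]
  obtain ⟨f, hf⟩ : ∃ f : Fin d → K, ∑ i ∈ U, f i • A.form i = A.form j := by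
    rw [← Submodule.mem_span_image_finset_iff_exists_fun', hU]
    simpa using hj
  set c : Fin d → K := fun i => if i = j then -1 else if i ∈ U then f i else 0 with hc
  have hcj : c j = -1 := by simp [hc]
  have hcrel : c ∈ A.relSpace := by
    have hU' : ∀ i ∈ U, c i • A.form i = f i • A.form i := fun i hi => by
      have : i ≠ j := fun h => hjU (h ▸ hi)
      simp [hc, this, hi]
    change ∑ i, c i • A.form i = 0
    rw [← Finset.sum_subset (Finset.subset_univ (insert j U)), Finset.sum_insert hjU, hcj,
      Finset.sum_congr rfl hU', hf]
    · simp
    · intro i _ hi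
      simp only [Finset.mem_insert, not_or] at hi
      simp [hc, hi.1, hi.2]
  set L := vsupp c with hL
  have hjL : j ∈ L := by simp [hL, vsupp, hcj]
  have hLU : L.erase j ⊆ U := by
    intro i hi
    simp only [Finset.mem_erase, hL, vsupp, Finset.mem_filter, Finset.mem_univ, true_and] at hi
    by_contra h
    exact hi.2 (by simp [hc, hi.1, h])
  set δ : Finset (Fin d) → Fin d →₀ ℕ := fun s => ∑ l ∈ s, Finsupp.single l 1 with hδ
  have hδj : δ (L.erase j) ≤ a := by
    intro i
    simp only [hδ, Finsupp.finsetSum_apply, Finsupp.single_apply, Finset.sum_ite_eq']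
    split_ifs with h
    · have := (Finset.mem_filter.1 (hLU h)).1
      exact Nat.one_le_iff_ne_zero.2 (Finsupp.mem_support_iff.1 this)
    · exact Nat.zero_le _
  set b := a - δ (L.erase j) with hb
  have hba : b + δ (L.erase j) = a := tsub_add_cancel_of_le hδj
  have hδk : ∀ k ∈ L, δ (L.erase k) + Finsupp.single k 1 = δ L := fun k hk =>
    Finset.sum_erase_add _ _ hk
  have hmem : monomial b 1 * otgen c ∈ A.otIdeal :=
    Ideal.mul_mem_left _ _ (Ideal.subset_span ⟨c, hcrel, rfl⟩)
  have hexp : monomial b 1 * otgen c =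
      ∑ k ∈ L, c k • monomial (b + δ (L.erase k)) (1 : K) := by
    rw [otgen, Finset.mul_sum]
    refine Finset.sum_congr rfl fun k _ => ?_
    rw [prod_X_eq_monomial, ← MvPolynomial.algebraMap_eq, ← Algebra.smul_def, mul_smul_comm,
      monomial_mul, one_mul]
  rw [hexp, ← Ideal.Quotient.eq_zero_iff_mem, ← Ideal.Quotient.mkₐ_eq_mk K, map_sum,
    ← Finset.add_sum_erase _ _ hjL, hcj, hba, map_smul, neg_one_smul, neg_add_eq_zero] at hmem
  rw [monomialClass, hmem]
  refine Submodule.sum_mem _ fun k hk => ?_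
  rw [map_smul]
  refine Submodule.smul_mem _ _ (Submodule.subset_span ⟨_, ⟨j, k, ?_, ?_⟩, rfl⟩)
  · exact (Finset.mem_filter.1 (hLU hk)).2
  · rw [← hba, add_assoc, add_assoc, hδk k (Finset.mem_of_mem_erase hk), hδk j hjL]

/-- Straightening: every monomial is a combination of nbc monomials of the same degree. -/
lemma monomialClass_mem_span_nbc (a : Fin d →₀ ℕ) :
    A.monomialClass a ∈ Submodule.span K
      (A.monomialClass '' {b | b.degree = a.degree ∧ IsNBC K A.form b.support}) := by
  induction hw : Finsupp.weight (fun i : Fin d => (i : ℕ)) a using Nat.strong_induction_on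
    generalizing a with
  | _ w ih =>
    by_cases ha : IsNBC K A.form a.support
    · exact Submodule.subset_span ⟨a, ⟨rfl, ha⟩, rfl⟩
    · refine Submodule.span_le.2 ?_ (A.monomialClass_mem_span_of_not_isNBC ha)
      rintro _ ⟨b, ⟨j, k, hjk, hbk⟩, rfl⟩
      have hdeg : b.degree = a.degree := by
        have := congrArg Finsupp.degree hbk
        simpa using this
      have hwt : Finsupp.weight (fun i : Fin d => (i : ℕ)) b < w := by
        have := congrArg (Finsupp.weight (fun i : Fin d => (i : ℕ))) hbk
        simp only [map_add, Finsupp.weight_single, one_smul, hw] at this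
        have : (j : ℕ) < k := hjk
        lia
      rw [← hdeg]
      exact ih _ hwt b rfl

lemma quotGradedPiece_eq_span (I : Ideal (MvPolynomial (Fin d) K)) (m : ℕ) :
    quotGradedPiece I m = Submodule.span K
      ((fun a => Ideal.Quotient.mkₐ K I (monomial a 1)) '' {a | a.degree = m}) := by
  rw [quotGradedPiece, homogeneousSubmodule_eq_finsupp_supported,
    AddMonoidAlgebra.supported_eq_span_single, Submodule.map_span, ← Set.image_comp]
  rfl

open Classical in
/-- The nbc monomials of degree `m` form a basis of the degree-`m` piece of the Orlik-Terao
algebra. -/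
lemma finrank_quotGradedPiece (m : ℕ) :
    Module.finrank K (quotGradedPiece A.otIdeal m) =
      ((Finset.finsuppAntidiag Finset.univ m).filter
        fun a : Fin d →₀ ℕ => IsNBC K A.form a.support).card := by
  set B := (Finset.finsuppAntidiag Finset.univ m).filter
        fun a : Fin d →₀ ℕ => IsNBC K A.form a.support with hB
  have hmemB : ∀ a, a ∈ B ↔ a.degree = m ∧ IsNBC K A.form a.support := fun a => by
    simp [hB, Finsupp.degree_eq_sum]
  have hspan : quotGradedPiece A.otIdeal m = Submodule.span K (A.monomialClass '' B) := by
    rw [quotGradedPiece_eq_span]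
    refine le_antisymm (Submodule.span_le.2 ?_)
      (Submodule.span_mono (Set.image_mono fun a ha => ((hmemB a).1 ha).1))
    rintro _ ⟨a, rfl, rfl⟩
    refine Submodule.span_mono (Set.image_mono ?_) (A.monomialClass_mem_span_nbc a)
    exact fun b hb => (hmemB b).2 hb
  rw [hspan, Set.image_eq_range, finrank_span_eq_card (b := fun a : (B : Set (Fin d →₀ ℕ)) =>
    A.monomialClass a) (A.linearIndepOn_monomialClass B fun a ha => ((hmemB a).1 ha).2)]
  simp

end CentralArrangement

open MvPolynomial PowerSeries in
open Classical in
/-- Let `A` be an essential central arrangement of `d` hyperplanes of rank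
`n` with Orlik-Terao ideal `I ⊆ R = K[y_1,…,y_d]`.  Then the Hilbert series of the
Orlik-Terao algebra `R/I` equals `P(A, t/(1−t))`, where
`P(A, t) = Σ_{X ∈ L(A)} μ(X) (−t)^{r(X)}` is the Poincaré polynomial of `A`. -/
theorem otAlgebra_hilbertSeries_eq_poincare
    (K : Type*) [Field K] (d n : ℕ)
    (A : CentralArrangement K (Fin d) n) :
    (PowerSeries.mk fun m =>
        (Module.finrank K ↥(quotGradedPiece A.otIdeal m) : ℚ)) =
      ∑ S ∈ Finset.univ.filter (fun S : Finset (Fin d) => A.IsFlat S),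
        (A.mobius S : PowerSeries ℚ) *
          ((-PowerSeries.X) ^ A.flatRank S *
            ((1 - PowerSeries.X : PowerSeries ℚ)⁻¹) ^ A.flatRank S) := by
  simp only [A.finrank_quotGradedPiece, ← mul_pow, neg_mul]
  rw [powerSeries_mk_card_eq_sum, CentralArrangement.sum_flats_eq_sum_nbc]
end
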